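/- Bilinear weak-type extrapolation at the diagonal: let $1\le p_1\le p_2$, $1/p=1/p_1+1/p_2$, and let $T$ be a bilinear operator such that $\|T(f_1,f_2)\|_{L^{p,\infty}(w_1^{p/p_1}w_2^{p/p_2})}\lesssim\|f_1\|_{L^{p_1}(w_1)}\|f_2\|_{L^{p_2}(w_2)}$ for all $w_1\in A_{p_1}$, $w_2\in A_{p_2}$. Then $T:L^{p_2}(w_1)\times L^{p_2}(w_2)\to L^{p_2/2,\infty}(w_1^{1/2}w_2^{1/2})$ is bounded for all $w_1,w_2\in A_{p_2}$. -/

import Mathlib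

open MeasureTheory ENNReal Set

noncomputable section

/-- An axis-parallel cube in `ℝⁿ`. -/
def IsCube {n : ℕ} (Q : Set (Fin n → ℝ)) : Prop :=
  ∃ (a : Fin n → ℝ) (r : ℝ), 0 < r ∧ Q = Set.Icc a (fun i => a i + r)

/-- Average of `w` over a set `Q` (w.r.t. Lebesgue measure). -/
def cubeAvg {n : ℕ} (w : (Fin n → ℝ) → ℝ≥0∞) (Q : Set (Fin n → ℝ)) : ℝ≥0∞ :=
  (∫⁻ x in Q, w x) / volume Q

/-- Hardy–Littlewood maximal operator (over cubes containing the point). -/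
def maxOp {n : ℕ} (f : (Fin n → ℝ) → ℝ≥0∞) (x : Fin n → ℝ) : ℝ≥0∞ :=
  ⨆ (Q : Set (Fin n → ℝ)) (_ : IsCube Q) (_ : x ∈ Q), cubeAvg f Q

/-- `M_μ f = (M(f^{1/μ}))^μ`. -/
def maxOpP {n : ℕ} (μ : ℝ) (f : (Fin n → ℝ) → ℝ≥0∞) (x : Fin n → ℝ) : ℝ≥0∞ :=
  (maxOp (fun y => f y ^ (1 / μ)) x) ^ μ

/-- Muckenhoupt `A_p` constant; for `p = 1` the least `C` with `Mw ≤ C w` a.e. -/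
def apConst {n : ℕ} (p : ℝ) (w : (Fin n → ℝ) → ℝ≥0∞) : ℝ≥0∞ :=
  if p = 1 then
    sInf {C : ℝ≥0∞ | ∀ᵐ x ∂(volume : Measure (Fin n → ℝ)), maxOp w x ≤ C * w x}
  else
    ⨆ (Q : Set (Fin n → ℝ)) (_ : IsCube Q),
      cubeAvg w Q * (cubeAvg (fun x => w x ^ (-1 / (p - 1))) Q) ^ (p - 1)

/-- `A_∞` "constant": infimum of the `A_p` constants over `p > 1`. -/
def ainfConst {n : ℕ} (w : (Fin n → ℝ) → ℝ≥0∞) : ℝ≥0∞ :=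
  ⨅ (p : ℝ) (_ : 1 < p), apConst p w

/-- `u(E) = ∫_E u`. -/
def wMeas {n : ℕ} (w : (Fin n → ℝ) → ℝ≥0∞) (E : Set (Fin n → ℝ)) : ℝ≥0∞ :=
  ∫⁻ x in E, w x

/-- `‖g‖_{L^{p,∞}(w)} = sup_y y · w({g>y})^{1/p}`. -/
def wkNorm {n : ℕ} (p : ℝ) (w g : (Fin n → ℝ) → ℝ≥0∞) : ℝ≥0∞ :=
  ⨆ y : ℝ≥0∞, y * (wMeas w {x | y < g x}) ^ (1 / p)

/-- `‖f‖_{L^p(w)}`. -/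
def stNorm {n : ℕ} (p : ℝ) (w f : (Fin n → ℝ) → ℝ≥0∞) : ℝ≥0∞ :=
  (∫⁻ x, f x ^ p * w x) ^ (1 / p)

/-- A locally bounded function `φ : [0,∞] → [0,∞]`. -/
def LocBdd (φ : ℝ≥0∞ → ℝ≥0∞) : Prop :=
  ∀ M : ℝ≥0∞, M ≠ ⊤ → ∃ C : ℝ≥0∞, C ≠ ⊤ ∧ ∀ t ≤ M, φ t ≤ C

/-- A (a.e.) positive, locally integrable weight. -/
def PosLocInt {n : ℕ} (u : (Fin n → ℝ) → ℝ≥0∞) : Prop :=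
  Measurable u ∧ (∀ᵐ x ∂(volume : Measure (Fin n → ℝ)), 0 < u x) ∧
    ∀ Q : Set (Fin n → ℝ), IsCube Q → (∫⁻ x in Q, u x) < ⊤

end

noncomputable section

def mMax {n : ℕ} (μ : Measure (Fin n → ℝ)) (f : (Fin n → ℝ) → ℝ≥0∞) (x : Fin n → ℝ) : ℝ≥0∞ :=
  ⨆ (c : Fin n → ℝ) (ρ : ℝ) (_ : 0 < ρ) (_ : x ∈ Metric.ball c ρ),
    (∫⁻ y in Metric.ball c ρ, f y ∂μ) / μ (Metric.ball c ρ)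

lemma lt_mMax_iff {n : ℕ} {μ : Measure (Fin n → ℝ)} {f : (Fin n → ℝ) → ℝ≥0∞} {x : Fin n → ℝ}
    {t : ℝ≥0∞} : t < mMax μ f x ↔ ∃ c ρ, 0 < ρ ∧ x ∈ Metric.ball c ρ ∧
      t < (∫⁻ y in Metric.ball c ρ, f y ∂μ) / μ (Metric.ball c ρ) := by
  simp only [mMax, lt_iSup_iff, exists_prop]

lemma le_mMax {n : ℕ} (μ : Measure (Fin n → ℝ)) (f : (Fin n → ℝ) → ℝ≥0∞) {x c : Fin n → ℝ}
    {ρ : ℝ} (hρ : 0 < ρ) (hx : x ∈ Metric.ball c ρ) :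
    (∫⁻ y in Metric.ball c ρ, f y ∂μ) / μ (Metric.ball c ρ) ≤ mMax μ f x :=
  le_iSup_of_le c <| le_iSup_of_le ρ <| le_iSup_of_le hρ <| le_iSup_of_le hx le_rfl

lemma measurable_mMax {n : ℕ} (μ : Measure (Fin n → ℝ)) (f : (Fin n → ℝ) → ℝ≥0∞) :
    Measurable (mMax μ f) := by
  refine measurable_of_Ioi fun t => ?_
  refine IsOpen.measurableSet ?_
  rw [isOpen_iff_forall_mem_open]
  intro x hx
  obtain ⟨c, ρ, hρ, hxc, h⟩ := lt_mMax_iff.1 hx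
  exact ⟨Metric.ball c ρ, fun z hz => lt_mMax_iff.2 ⟨c, ρ, hρ, hz, h⟩, Metric.isOpen_ball, hxc⟩

lemma mMax_weak {n : ℕ} (μ : Measure (Fin n → ℝ)) (D : ℝ≥0∞)
    (hD : ∀ c ρ, 0 < ρ → μ (Metric.closedBall c (5 * ρ)) ≤ D * μ (Metric.ball c ρ))
    (f : (Fin n → ℝ) → ℝ≥0∞) (t : ℝ≥0∞) :
    t * μ {x | t < mMax μ f x} ≤ D * ∫⁻ x, f x ∂μ := by
  let S : ℕ → Set ((Fin n → ℝ) × ℝ) := fun N => {a | 0 < a.2 ∧ a.2 ≤ N ∧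
    t < (∫⁻ y in Metric.ball a.1 a.2, f y ∂μ) / μ (Metric.ball a.1 a.2)}
  let A : ℕ → Set (Fin n → ℝ) := fun N => ⋃ a ∈ S N, Metric.ball a.1 a.2
  have hA : {x | t < mMax μ f x} = ⋃ N, A N := by
    ext x
    simp only [mem_ofPred_eq, lt_mMax_iff, mem_iUnion, A, S]
    constructor
    · rintro ⟨c, ρ, hρ, hx, h⟩
      obtain ⟨N, hN⟩ := exists_nat_ge ρ
      exact ⟨N, (c, ρ), ⟨hρ, hN, h⟩, hx⟩
    · rintro ⟨N, ⟨c, ρ⟩, ⟨hρ, hN, h⟩, hx⟩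
      exact ⟨c, ρ, hρ, hx, h⟩
  have hmono : Monotone A := by
    intro N N' hN
    refine biUnion_subset_biUnion_left ?_
    rintro a ⟨h1, h2, h3⟩
    exact ⟨h1, h2.trans (by exact_mod_cast hN), h3⟩
  rw [hA, hmono.measure_iUnion, ENNReal.mul_iSup]
  refine iSup_le fun N => ?_
  obtain ⟨u, hu, hdisj, hcov⟩ := Vitali.exists_disjoint_subfamily_covering_enlargement_closedBall
    (S N) (fun a => a.1) (fun a => a.2) N (fun a ha => ha.2.1) 5 (by norm_num)
  have hdisj' : u.PairwiseDisjoint fun a => Metric.ball a.1 a.2 :=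
    hdisj.mono fun a => Metric.ball_subset_closedBall
  have hcount : u.Countable := by
    refine hdisj'.countable_of_isOpen (fun a _ => Metric.isOpen_ball) fun a ha => ?_
    exact ⟨a.1, Metric.mem_ball_self (hu ha).1⟩
  have hsub : A N ⊆ ⋃ b ∈ u, Metric.closedBall b.1 (5 * b.2) := by
    intro x hx
    simp only [A, mem_iUnion] at hx ⊢
    obtain ⟨a, ha, hx⟩ := hx
    obtain ⟨b, hb, hab⟩ := hcov a ha
    exact ⟨b, hb, hab (Metric.ball_subset_closedBall hx)⟩
  have := hcount.to_subtype
  calc t * μ (A N) ≤ t * ∑' b : u, μ (Metric.closedBall b.1.1 (5 * b.1.2)) := by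
        gcongr
        exact (measure_mono hsub).trans (measure_biUnion_le μ hcount _)
    _ ≤ t * ∑' b : u, D * μ (Metric.ball b.1.1 b.1.2) := by
        gcongr with b
        exact hD _ _ (hu b.2).1
    _ = D * ∑' b : u, t * μ (Metric.ball b.1.1 b.1.2) := by
        rw [ENNReal.tsum_mul_left, ENNReal.tsum_mul_left]; ring
    _ ≤ D * ∑' b : u, ∫⁻ y in Metric.ball b.1.1 b.1.2, f y ∂μ := by
        gcongr with b
        exact ENNReal.mul_le_of_le_div (hu b.2).2.2.le
    _ = D * ∫⁻ y in ⋃ b : u, Metric.ball b.1.1 b.1.2, f y ∂μ := by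
        rw [lintegral_iUnion (fun b => Metric.isOpen_ball.measurableSet)]
        exact fun a b hab => hdisj' a.2 b.2 (fun h => hab (Subtype.ext h))
    _ ≤ D * ∫⁻ x, f x ∂μ := by
        gcongr
        exact Measure.restrict_le_self

lemma lintegral_pow_lt (q : ℝ) (hq : 0 < q) (a : ℝ≥0∞) :
    ∫⁻ t in Ioi (0:ℝ), (if ENNReal.ofReal t < a then ENNReal.ofReal (t ^ (q - 1)) else 0)
      = ENNReal.ofReal (1 / q) * a ^ q := by
  have key : ∀ b : ℝ, 0 < b →
      ∫⁻ t in Ioi (0:ℝ), (if ENNReal.ofReal t < ENNReal.ofReal b then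
        ENNReal.ofReal (t ^ (q - 1)) else 0) = ENNReal.ofReal (1 / q) * ENNReal.ofReal b ^ q := by
    intro b hb
    have e1 : ∫⁻ t in Ioi (0:ℝ), (if ENNReal.ofReal t < ENNReal.ofReal b then
        ENNReal.ofReal (t ^ (q - 1)) else 0) = ∫⁻ t in Ioo 0 b, ENNReal.ofReal (t ^ (q - 1)) := by
      rw [← lintegral_indicator measurableSet_Ioi, ← lintegral_indicator measurableSet_Ioo]
      congr 1; ext t
      simp only [indicator, mem_Ioi, mem_Ioo, ENNReal.ofReal_lt_ofReal_iff hb]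
      split_ifs <;> simp_all
    have h_integ : IntervalIntegrable (fun t : ℝ => t ^ (q - 1)) volume 0 b :=
      intervalIntegral.intervalIntegrable_rpow' (by linarith)
    rw [e1, Measure.restrict_congr_set Ioo_ae_eq_Ioc, ← ofReal_integral_eq_lintegral_ofReal]
    · rw [← intervalIntegral.integral_of_le hb.le, integral_rpow (Or.inl (by linarith))]
      simp only [sub_add_cancel]
      rw [Real.zero_rpow hq.ne', sub_zero, ENNReal.ofReal_rpow_of_pos hb,
        ← ENNReal.ofReal_mul (by positivity)]
      congr 1; ring
    · exact (intervalIntegrable_iff_integrableOn_Ioc_of_le hb.le).1 h_integ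
    · filter_upwards [ae_restrict_mem measurableSet_Ioc] with t ht
      exact Real.rpow_nonneg ht.1.le _
  rcases eq_or_ne a ⊤ with rfl | ha
  · rw [ENNReal.top_rpow_of_pos hq, ENNReal.mul_top (by simpa using hq)]
    refine ENNReal.eq_top_of_forall_nnreal_le fun r => ?_
    have hr : (0:ℝ) < (q * (r + 1)) ^ (1 / q) := by positivity
    calc (r : ℝ≥0∞) ≤ ENNReal.ofReal (1 / q) * ENNReal.ofReal ((q * (r + 1)) ^ (1 / q)) ^ q := by
          rw [ENNReal.ofReal_rpow_of_pos hr, ← ENNReal.ofReal_mul (by positivity),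
            ← Real.rpow_mul (by positivity), one_div, inv_mul_cancel₀ hq.ne', Real.rpow_one,
            inv_mul_cancel_left₀ hq.ne', ← ENNReal.ofReal_coe_nnreal]
          exact ENNReal.ofReal_le_ofReal (by linarith)
      _ ≤ _ := by
          rw [← key _ hr]
          gcongr with t
          by_cases h : ENNReal.ofReal t < ENNReal.ofReal ((q * (r + 1)) ^ (1 / q))
          · rw [if_pos h, if_pos ENNReal.ofReal_lt_top]
          · rw [if_neg h]; exact bot_le
  · rcases eq_or_ne a 0 with rfl | h0
    · simp [ENNReal.zero_rpow_of_pos hq]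
    · have := key a.toReal (ENNReal.toReal_pos h0 ha)
      rwa [ENNReal.ofReal_toReal ha] at this

/-- truncation -/
lemma mMax_lt_trunc {n : ℕ} (μ : Measure (Fin n → ℝ)) (f : (Fin n → ℝ) → ℝ≥0∞)
    (t : ℝ≥0∞) (ht : t ≠ ⊤) :
    {x | 2 * t < mMax μ f x} ⊆ {x | t < mMax μ (fun y => if t < f y then f y else 0) x} := by
  intro x hx
  simp only [mem_ofPred_eq] at hx ⊢
  obtain ⟨c, ρ, hρ, hxc, h⟩ := lt_mMax_iff.1 hx
  refine lt_mMax_iff.2 ⟨c, ρ, hρ, hxc, ?_⟩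
  have h2 : (∫⁻ y in Metric.ball c ρ, f y ∂μ) ≤
      t * μ (Metric.ball c ρ) +
      (∫⁻ y in Metric.ball c ρ, (if t < f y then f y else 0) ∂μ) := by
    rw [← setLIntegral_const, ← lintegral_add_left measurable_const]
    gcongr with y
    split_ifs with h
    · exact le_add_self
    · simpa using h
  have h3 : (∫⁻ y in Metric.ball c ρ, f y ∂μ) / μ (Metric.ball c ρ) ≤
      t + (∫⁻ y in Metric.ball c ρ, (if t < f y then f y else 0) ∂μ) / μ (Metric.ball c ρ) := by
    refine (ENNReal.div_le_div_right h2 _).trans ?_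
    rw [ENNReal.add_div]
    gcongr
    exact ENNReal.div_le_of_le_mul le_rfl
  have h4 := h.trans_le h3
  rw [two_mul] at h4
  exact (ENNReal.add_lt_add_iff_left ht).1 h4

lemma mMax_strong {n : ℕ} (μ : Measure (Fin n → ℝ)) [SFinite μ] (D : ℝ≥0∞) (hDtop : D ≠ ⊤)
    (hD : ∀ c ρ, 0 < ρ → μ (Metric.closedBall c (5 * ρ)) ≤ D * μ (Metric.ball c ρ))
    (q : ℝ) (hq : 1 < q) : ∃ C : ℝ≥0∞, C ≠ ⊤ ∧ ∀ f : (Fin n → ℝ) → ℝ≥0∞, Measurable f →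
      ∫⁻ x, mMax μ f x ^ q ∂μ ≤ C * ∫⁻ x, f x ^ q ∂μ := by
  have hq0 : 0 < q := by linarith
  refine ⟨ENNReal.ofReal q * (2 ^ q * (D * ENNReal.ofReal (1 / (q - 1)))), by finiteness, ?_⟩
  intro f hf
  have hM := measurable_mMax μ f
  -- layer cake
  have L : ENNReal.ofReal (1 / q) * ∫⁻ x, (mMax μ f x / 2) ^ q ∂μ
      = ∫⁻ t in Ioi (0:ℝ), ENNReal.ofReal (t ^ (q - 1)) *
        μ {x | 2 * ENNReal.ofReal t < mMax μ f x} := by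
    rw [← lintegral_const_mul _ (by fun_prop)]
    simp_rw [← lintegral_pow_lt q hq0]
    rw [lintegral_lintegral_swap]
    · refine lintegral_congr fun t => ?_
      rw [← lintegral_indicator_const]
      · refine lintegral_congr fun x => ?_
        simp only [indicator, mem_ofPred_eq]
        congr 1
        rw [ENNReal.lt_div_iff_mul_lt (by simp) (by simp), mul_comm]
      · exact measurableSet_lt measurable_const hM
    · refine Measurable.aemeasurable ?_
      refine Measurable.ite ?_ (by fun_prop) measurable_const
      exact measurableSet_lt (by fun_prop) (by fun_prop)
  have R : ∫⁻ t in Ioi (0:ℝ), ENNReal.ofReal (t ^ (q - 1)) *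
        μ {x | 2 * ENNReal.ofReal t < mMax μ f x}
      ≤ D * (ENNReal.ofReal (1 / (q - 1)) * ∫⁻ x, f x ^ q ∂μ) := by
    calc _ ≤ ∫⁻ t in Ioi (0:ℝ), D * ∫⁻ x, f x *
            (if ENNReal.ofReal t < f x then ENNReal.ofReal (t ^ ((q - 1) - 1)) else 0) ∂μ := by
          refine setLIntegral_mono' measurableSet_Ioi fun t ht => ?_
          have ht : 0 < t := ht
          have h1 := mMax_weak μ D hD
            (fun y => if ENNReal.ofReal t < f y then f y else 0) (ENNReal.ofReal t)
          have h2 : t ^ (q - 1) = t ^ (q - 1 - 1) * t := by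
            rw [← Real.rpow_add_one ht.ne']; congr 1; ring
          rw [h2, ENNReal.ofReal_mul (by positivity), mul_assoc]
          calc _ ≤ ENNReal.ofReal (t ^ (q - 1 - 1)) * (ENNReal.ofReal t *
                μ {x | ENNReal.ofReal t < mMax μ (fun y => if ENNReal.ofReal t < f y then f y else 0) x}) := by
                refine mul_le_mul_right (mul_le_mul_right (measure_mono ?_) _) _
                exact mMax_lt_trunc μ f _ ENNReal.ofReal_ne_top
            _ ≤ ENNReal.ofReal (t ^ (q - 1 - 1)) * (D * ∫⁻ x, (if ENNReal.ofReal t < f x then f x else 0) ∂μ) := by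
                gcongr
            _ = D * ∫⁻ x, ENNReal.ofReal (t ^ (q - 1 - 1)) * (if ENNReal.ofReal t < f x then f x else 0) ∂μ := by
                rw [lintegral_const_mul _ ?_]
                · ring
                · exact Measurable.ite (measurableSet_lt measurable_const hf) hf measurable_const
            _ = _ := by
                congr 1
                refine lintegral_congr fun x => ?_
                split_ifs
                · ring
                · simp
      _ = D * ∫⁻ x, f x * (∫⁻ t in Ioi (0:ℝ),
            (if ENNReal.ofReal t < f x then ENNReal.ofReal (t ^ ((q - 1) - 1)) else 0)) ∂μ := by
          rw [lintegral_const_mul' _ _ hDtop]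
          congr 1
          rw [lintegral_lintegral_swap]
          · refine lintegral_congr fun x => ?_
            rw [lintegral_const_mul]
            refine Measurable.ite ?_ (by fun_prop) measurable_const
            exact measurableSet_lt (by fun_prop) (by fun_prop)
          · refine Measurable.aemeasurable ?_
            refine Measurable.mul (by fun_prop) (Measurable.ite ?_ (by fun_prop) measurable_const)
            exact measurableSet_lt (by fun_prop) (by fun_prop)
      _ = _ := by
          congr 1
          rw [← lintegral_const_mul _ (by fun_prop)]
          refine lintegral_congr fun x => ?_
          rw [lintegral_pow_lt (q - 1) (by linarith)]
          have : f x ^ q = f x * f x ^ (q - 1) := by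
            conv_rhs => enter [1]; rw [← ENNReal.rpow_one (f x)]
            rw [← ENNReal.rpow_add_of_nonneg _ _ (by linarith) (by linarith)]; congr 1; ring
          rw [this]; ring
  rw [← L] at R
  have hh : ∫⁻ x, mMax μ f x ^ q ∂μ
      = ENNReal.ofReal q * (2 ^ q * (ENNReal.ofReal (1 / q) * ∫⁻ x, (mMax μ f x / 2) ^ q ∂μ)) := by
    have e : ∫⁻ x, mMax μ f x ^ q ∂μ = 2 ^ q * ∫⁻ x, (mMax μ f x / 2) ^ q ∂μ := by
      rw [← lintegral_const_mul _ (by fun_prop)]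
      refine lintegral_congr fun x => ?_
      rw [← ENNReal.mul_rpow_of_nonneg _ _ hq0.le, ENNReal.mul_div_cancel (by simp) (by simp)]
    have e2 : ENNReal.ofReal q * ENNReal.ofReal (1 / q) = 1 := by
      rw [← ENNReal.ofReal_mul hq0.le, mul_one_div_cancel hq0.ne', ENNReal.ofReal_one]
    rw [e]
    calc _ = (ENNReal.ofReal q * ENNReal.ofReal (1 / q)) * (2 ^ q * ∫⁻ x, (mMax μ f x / 2) ^ q ∂μ) := by
          rw [e2, one_mul]
      _ = _ := by ring
  rw [hh]
  calc _ ≤ ENNReal.ofReal q * (2 ^ q * (D * (ENNReal.ofReal (1 / (q - 1)) *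
        ∫⁻ x, f x ^ q ∂μ))) := by gcongr
    _ = _ := by ring

lemma isCube_iff {n : ℕ} {Q : Set (Fin n → ℝ)} :
    IsCube Q ↔ ∃ c ρ, 0 < ρ ∧ Q = Metric.closedBall c ρ := by
  constructor
  · rintro ⟨a, r, hr, rfl⟩
    refine ⟨fun i => a i + r / 2, r / 2, by positivity, ?_⟩
    rw [closedBall_pi _ (by positivity), ← Set.pi_univ_Icc]
    congr 1; ext1 i
    rw [Real.closedBall_eq_Icc]; congr 1 <;> ring
  · rintro ⟨c, ρ, hρ, rfl⟩
    refine ⟨fun i => c i - ρ, 2 * ρ, by positivity, ?_⟩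
    rw [closedBall_pi _ hρ.le, ← Set.pi_univ_Icc]
    congr 1; ext1 i
    rw [Real.closedBall_eq_Icc]; congr 1; ring

lemma vol_cb {n : ℕ} (c : Fin n → ℝ) {ρ : ℝ} (hρ : 0 < ρ) (k : ℝ) (hk : 0 < k) :
    volume (Metric.closedBall c (k * ρ)) = ENNReal.ofReal (k ^ n) * volume (Metric.ball c ρ) := by
  rw [Real.volume_pi_closedBall _ (by positivity), Real.volume_pi_ball _ hρ,
    ← ENNReal.ofReal_mul (by positivity)]
  congr 1
  simp only [Fintype.card_fin]
  rw [← mul_pow]; congr 1; ring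

lemma vol_ball_ne_zero {n : ℕ} (c : Fin n → ℝ) {ρ : ℝ} (hρ : 0 < ρ) :
    volume (Metric.ball c ρ) ≠ 0 := (Metric.measure_ball_pos _ _ hρ).ne'

lemma vol_ball_ne_top {n : ℕ} (c : Fin n → ℝ) {ρ : ℝ} :
    volume (Metric.ball c ρ) ≠ ⊤ := measure_ball_lt_top.ne

lemma vol_cb_eq {n : ℕ} (c : Fin n → ℝ) {ρ : ℝ} (hρ : 0 < ρ)  :
    volume (Metric.closedBall c ρ) = volume (Metric.ball c ρ) := by
  have := vol_cb c hρ 1 one_pos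
  simpa using this

lemma cube_vol {n : ℕ} {Q : Set (Fin n → ℝ)} (hQ : IsCube Q) :
    volume Q ≠ 0 ∧ volume Q ≠ ⊤ ∧ MeasurableSet Q := by
  obtain ⟨c, ρ, hρ, rfl⟩ := isCube_iff.1 hQ
  rw [vol_cb_eq c hρ]
  exact ⟨vol_ball_ne_zero c hρ, vol_ball_ne_top c, Metric.isClosed_closedBall.measurableSet⟩

/-- An abstract `A_{1+e}` pair. -/
structure ApPair {n : ℕ} (e : ℝ) (K : ℝ≥0∞) (w σ : (Fin n → ℝ) → ℝ≥0∞) : Prop where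
  he : 0 < e
  hK : K ≠ ⊤
  mw : Measurable w
  ms : Measurable σ
  lower : ∀ A, MeasurableSet A →
    volume A ^ (1 + e) ≤ (∫⁻ x in A, w x) * (∫⁻ x in A, σ x) ^ e
  upper : ∀ c ρ, 0 < ρ → (∫⁻ x in Metric.closedBall c ρ, w x) *
    (∫⁻ x in Metric.closedBall c ρ, σ x) ^ e ≤ K * volume (Metric.closedBall c ρ) ^ (1 + e)

lemma ApPair.symm {n : ℕ} {e : ℝ} {K : ℝ≥0∞} {w σ : (Fin n → ℝ) → ℝ≥0∞} (h : ApPair e K w σ) :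
    ApPair (1 / e) (K ^ (1 / e)) σ w := by
  have he := h.he
  have e0 : 0 ≤ 1 / e := by positivity
  have e1 : (1 + e) * (1 / e) = 1 + 1 / e := by field_simp; ring
  have e2 : e * (1 / e) = 1 := by field_simp
  refine ⟨by positivity, ENNReal.rpow_ne_top_of_nonneg e0 h.hK, h.ms, h.mw, ?_, ?_⟩
  · intro A hA
    have := ENNReal.rpow_le_rpow (h.lower A hA) e0
    rwa [ENNReal.mul_rpow_of_nonneg _ _ e0, ← ENNReal.rpow_mul, ← ENNReal.rpow_mul, e1, e2,
      ENNReal.rpow_one, mul_comm] at this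
  · intro c ρ hρ
    have := ENNReal.rpow_le_rpow (h.upper c ρ hρ) e0
    rwa [ENNReal.mul_rpow_of_nonneg _ _ e0, ENNReal.mul_rpow_of_nonneg _ _ e0,
      ← ENNReal.rpow_mul, ← ENNReal.rpow_mul, e1, e2,
      ENNReal.rpow_one, mul_comm] at this

lemma ApPair.upper' {n : ℕ} {e : ℝ} {K : ℝ≥0∞} {w σ : (Fin n → ℝ) → ℝ≥0∞} (h : ApPair e K w σ)
    (c : Fin n → ℝ) (ρ : ℝ) (hρ : 0 < ρ) : (∫⁻ x in Metric.ball c ρ, w x) *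
    (∫⁻ x in Metric.ball c ρ, σ x) ^ e ≤ K * volume (Metric.ball c ρ) ^ (1 + e) := by
  have := h.upper c ρ hρ
  rw [vol_cb_eq c hρ] at this
  refine le_trans ?_ this
  have := h.he
  gcongr
  · exact Metric.ball_subset_closedBall
  · exact Metric.ball_subset_closedBall

lemma ApPair.w_ne {n : ℕ} {e : ℝ} {K : ℝ≥0∞} {w σ : (Fin n → ℝ) → ℝ≥0∞} (h : ApPair e K w σ)
    (c : Fin n → ℝ) (ρ : ℝ) (hρ : 0 < ρ) : (∫⁻ x in Metric.ball c ρ, w x) ≠ 0 ∧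
      (∫⁻ x in Metric.ball c ρ, w x) ≠ ⊤ := by
  have he := h.he
  have h1 := h.lower _ (Metric.isOpen_ball (x := c) (ε := ρ)).measurableSet
  have h2 := h.upper' c ρ hρ
  have v0 := vol_ball_ne_zero c hρ
  have v1 := vol_ball_ne_top c (ρ := ρ)
  have v2 : volume (Metric.ball c ρ) ^ (1 + e) ≠ 0 := by
    simp [ENNReal.rpow_eq_zero_iff, v0, v1]
  have v3 : K * volume (Metric.ball c ρ) ^ (1 + e) ≠ ⊤ :=
    ENNReal.mul_ne_top h.hK (ENNReal.rpow_ne_top_of_nonneg (by positivity) v1)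
  constructor
  · intro h0
    rw [h0, zero_mul] at h1
    exact v2 (le_antisymm h1 bot_le)
  · intro h0
    rw [h0] at h1 h2
    have : (∫⁻ x in Metric.ball c ρ, σ x) ^ e ≠ 0 := by
      intro h; rw [h, mul_zero] at h1
      exact v2 (le_antisymm h1 bot_le)
    rw [ENNReal.top_mul this] at h2
    exact v3 (top_le_iff.1 h2)

lemma ApPair.doubling {n : ℕ} {e : ℝ} {K : ℝ≥0∞} {w σ : (Fin n → ℝ) → ℝ≥0∞} (h : ApPair e K w σ) :
    ∀ c ρ, 0 < ρ → volume.withDensity w (Metric.closedBall c (5 * ρ)) ≤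
      (K * ENNReal.ofReal (5 ^ n) ^ (1 + e)) * volume.withDensity w (Metric.ball c ρ) := by
  intro c ρ hρ
  have he := h.he
  rw [withDensity_apply _ Metric.isClosed_closedBall.measurableSet,
    withDensity_apply _ Metric.isOpen_ball.measurableSet]
  have h1 := h.lower _ (Metric.isOpen_ball (x := c) (ε := ρ)).measurableSet
  have h2 := h.upper c (5 * ρ) (by positivity)
  rw [vol_cb c hρ 5 (by norm_num), ENNReal.mul_rpow_of_nonneg _ _ (by positivity)] at h2
  have v0 := vol_ball_ne_zero c hρ
  have v1 := vol_ball_ne_top c (ρ := ρ)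
  have v2 : volume (Metric.ball c ρ) ^ (1 + e) ≠ 0 := by
    simp [ENNReal.rpow_eq_zero_iff, v0, v1]
  have v3 : volume (Metric.ball c ρ) ^ (1 + e) ≠ ⊤ :=
    (ENNReal.rpow_ne_top_of_nonneg (by positivity) v1)
  have sub : Metric.ball c ρ ⊆ Metric.closedBall c (5 * ρ) :=
    Metric.ball_subset_closedBall.trans (Metric.closedBall_subset_closedBall (by linarith))
  rw [← ENNReal.mul_le_mul_iff_left v2 v3]
  calc _ ≤ (∫⁻ x in Metric.closedBall c (5 * ρ), w x) *
        ((∫⁻ x in Metric.ball c ρ, w x) * (∫⁻ x in Metric.closedBall c (5 * ρ), σ x) ^ e) := by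
        gcongr
        refine h1.trans ?_
        gcongr
    _ = ((∫⁻ x in Metric.closedBall c (5 * ρ), w x) *
        (∫⁻ x in Metric.closedBall c (5 * ρ), σ x) ^ e) * (∫⁻ x in Metric.ball c ρ, w x)  := by
        ring
    _ ≤ _ := by
        refine (mul_le_mul_left h2 _).trans (le_of_eq ?_)
        ring

lemma ApPair.strong {n : ℕ} {e : ℝ} {K : ℝ≥0∞} {w σ : (Fin n → ℝ) → ℝ≥0∞} (h : ApPair e K w σ)
    (q : ℝ) (hq : 1 < q) : ∃ C : ℝ≥0∞, C ≠ ⊤ ∧ ∀ f : (Fin n → ℝ) → ℝ≥0∞, Measurable f →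
      ∫⁻ x, mMax (volume.withDensity w) f x ^ q * w x ≤ C * ∫⁻ x, f x ^ q * w x := by
  have he := h.he
  have hfin : K * ENNReal.ofReal (5 ^ n) ^ (1 + e) ≠ ⊤ :=
    ENNReal.mul_ne_top h.hK (ENNReal.rpow_ne_top_of_nonneg (by positivity) (by simp))
  obtain ⟨C, hC, H⟩ := mMax_strong (volume.withDensity w) _ hfin h.doubling q hq
  · refine ⟨C, hC, fun f hf => ?_⟩
    have := H f hf
    have hm := measurable_mMax (volume.withDensity w) f
    rw [lintegral_withDensity_eq_lintegral_mul _ h.mw (by fun_prop),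
      lintegral_withDensity_eq_lintegral_mul _ h.mw (by fun_prop)] at this
    simpa only [Pi.mul_apply, mul_comm (w _)] using this

lemma maxOp_le_mMax {n : ℕ} (f : (Fin n → ℝ) → ℝ≥0∞) (x : Fin n → ℝ) :
    maxOp f x ≤ ENNReal.ofReal (2 ^ n) * mMax volume f x := by
  refine iSup_le fun Q => iSup_le fun hQ => iSup_le fun hx => ?_
  obtain ⟨c, ρ, hρ, rfl⟩ := isCube_iff.1 hQ
  have h2 : (0:ℝ) < 2 * ρ := by positivity
  have hx' : x ∈ Metric.ball c (2 * ρ) := by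
    rw [Metric.mem_closedBall] at hx; rw [Metric.mem_ball]; linarith
  refine le_trans ?_ (mul_le_mul_right (le_mMax volume f h2 hx') _)
  unfold cubeAvg
  rw [← vol_cb_eq c h2, vol_cb c hρ 2 two_pos, vol_cb_eq c hρ, ← mul_div_assoc,
    ENNReal.mul_div_mul_left _ _ (by simp) (by simp)]
  gcongr
  intro y hy
  rw [Metric.mem_closedBall] at hy; rw [Metric.mem_ball]; linarith

lemma lerner {n : ℕ} {e : ℝ} {K : ℝ≥0∞} {w σ : (Fin n → ℝ) → ℝ≥0∞} (h : ApPair e K w σ)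
    (hσ : ∀ x, σ x ≠ 0 ∧ σ x ≠ ⊤) (u : (Fin n → ℝ) → ℝ≥0∞) (hu : Measurable u) (x : Fin n → ℝ) :
    mMax volume (fun y => u y * w y) x ≤ K * (mMax (volume.withDensity σ)
      (fun y => mMax (volume.withDensity w) u y ^ (1 / e) * (σ y)⁻¹) x) ^ e := by
  have he := h.he
  refine iSup_le fun c => iSup_le fun ρ => iSup_le fun hρ => iSup_le fun hx => ?_
  have mB : MeasurableSet (Metric.ball c ρ) := Metric.isOpen_ball.measurableSet
  have hm := measurable_mMax (volume.withDensity w) u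
  have mw := h.mw
  have ms := h.ms
  refine le_trans ?_ (mul_le_mul_right (ENNReal.rpow_le_rpow (le_mMax _ _ hρ hx) he.le) _)
  rw [withDensity_apply _ mB, setLIntegral_withDensity_eq_setLIntegral_mul _ h.ms (by fun_prop) mB]
  have e1 : ∫⁻ y in Metric.ball c ρ, (σ * fun y => mMax (volume.withDensity w) u y ^ (1 / e) * (σ y)⁻¹) y
      = ∫⁻ y in Metric.ball c ρ, mMax (volume.withDensity w) u y ^ (1 / e) := by
    refine lintegral_congr fun y => ?_
    simp only [Pi.mul_apply]
    rw [mul_comm, mul_assoc, ENNReal.inv_mul_cancel (hσ y).1 (hσ y).2, mul_one]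
  rw [e1]
  obtain ⟨w0, w1⟩ := h.w_ne c ρ hρ
  obtain ⟨s0, s1⟩ := h.symm.w_ne c ρ hρ
  have up := h.upper' c ρ hρ
  have v0 := vol_ball_ne_zero c hρ
  have v1 := vol_ball_ne_top c (ρ := ρ)
  set W := ∫⁻ x in Metric.ball c ρ, w x
  set S := ∫⁻ x in Metric.ball c ρ, σ x
  set V := volume (Metric.ball c ρ)
  set m := (∫⁻ x in Metric.ball c ρ, u x * w x) / W with hmdef
  have hle : m ^ (1 / e) * V ≤ ∫⁻ y in Metric.ball c ρ, mMax (volume.withDensity w) u y ^ (1 / e) := by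
    rw [← setLIntegral_const]
    refine setLIntegral_mono' mB fun y hy => ?_
    refine ENNReal.rpow_le_rpow ?_ (by positivity)
    refine le_trans (le_of_eq ?_) (le_mMax _ _ hρ hy)
    rw [withDensity_apply _ mB, setLIntegral_withDensity_eq_setLIntegral_mul _ h.mw (by fun_prop) mB]
    simp only [Pi.mul_apply, mul_comm (w _)]
    rfl
  have h_integ : (∫⁻ x in Metric.ball c ρ, u x * w x) = m * W := by
    rw [hmdef, ENNReal.div_mul_cancel w0 w1]
  calc (∫⁻ x in Metric.ball c ρ, u x * w x) / V = m * W / V := by rw [h_integ]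
    _ ≤ K * (m ^ (1 / e) * V / S) ^ e := by
        rw [ENNReal.div_rpow_of_nonneg _ _ he.le, ENNReal.mul_rpow_of_nonneg _ _ he.le,
          ← ENNReal.rpow_mul, one_div_mul_cancel he.ne', ENNReal.rpow_one]
        refine ENNReal.div_le_of_le_mul ?_
        have s2 : S ^ e ≠ 0 := by simp [ENNReal.rpow_eq_zero_iff, s0, s1]
        have s3 : S ^ e ≠ ⊤ := ENNReal.rpow_ne_top_of_nonneg he.le s1
        rw [← ENNReal.mul_le_mul_iff_left s2 s3]
        calc m * W * S ^ e = m * (W * S ^ e) := by ring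
          _ ≤ m * (K * V ^ (1 + e)) := by gcongr
          _ = K * (m * V ^ e) * V := by
              rw [ENNReal.rpow_add _ _ v0 v1, ENNReal.rpow_one]; ring
          _ = K * (m * V ^ e / S ^ e * S ^ e) * V := by
              rw [ENNReal.div_mul_cancel s2 s3]
          _ = _ := by ring
    _ ≤ _ := by gcongr

lemma holder_lower {n : ℕ} (r : ℝ) (hr : 1 < r) (w : (Fin n → ℝ) → ℝ≥0∞) (hw : Measurable w)
    (h : ∀ᵐ x ∂(volume : Measure (Fin n → ℝ)), w x ≠ 0 ∧ w x ≠ ⊤) (A : Set (Fin n → ℝ)) :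
    volume A ^ r ≤ (∫⁻ x in A, w x) * (∫⁻ x in A, w x ^ (-1 / (r - 1))) ^ (r - 1) := by
  have hr0 : 0 < r := by linarith
  have hr1 : 0 < r - 1 := by linarith
  have H := ENNReal.lintegral_mul_norm_pow_le (μ := volume.restrict A) (f := w)
    (g := fun x => w x ^ (-1 / (r - 1))) (by fun_prop) (by fun_prop) (p := 1 / r) (q := (r - 1) / r)
    (by positivity) (by positivity) (by field_simp; ring)
  have e1 : ∫⁻ x in A, w x ^ (1 / r) * (w x ^ (-1 / (r - 1))) ^ ((r - 1) / r) = volume A := by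
    rw [← setLIntegral_one]
    refine lintegral_congr_ae ?_
    filter_upwards [ae_restrict_of_ae h] with x hx
    rw [← ENNReal.rpow_mul, ← ENNReal.rpow_add _ _ hx.1 hx.2]
    have : 1 / r + -1 / (r - 1) * ((r - 1) / r) = 0 := by field_simp; ring
    rw [this, ENNReal.rpow_zero]
  rw [e1] at H
  have := ENNReal.rpow_le_rpow H hr0.le
  rw [ENNReal.mul_rpow_of_nonneg _ _ hr0.le, ← ENNReal.rpow_mul, ← ENNReal.rpow_mul,
    one_div_mul_cancel hr0.ne', div_mul_cancel₀ _ hr0.ne', ENNReal.rpow_one] at this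
  exact this

lemma cube_prod_le {n : ℕ} (r : ℝ) (hr : 1 < r) (w : (Fin n → ℝ) → ℝ≥0∞) {Q : Set (Fin n → ℝ)}
    (hQ : IsCube Q) :
    (∫⁻ x in Q, w x) * (∫⁻ x in Q, w x ^ (-1 / (r - 1))) ^ (r - 1) ≤
      apConst r w * volume Q ^ r := by
  obtain ⟨v0, v1, _⟩ := cube_vol hQ
  have hr1 : 0 < r - 1 := by linarith
  have h1 : cubeAvg w Q * (cubeAvg (fun x => w x ^ (-1 / (r - 1))) Q) ^ (r - 1) ≤ apConst r w := by
    rw [apConst, if_neg hr.ne']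
    exact le_iSup₂_of_le Q hQ le_rfl
  have e : volume Q ^ r = volume Q * volume Q ^ (r - 1) := by
    conv_rhs => enter [1]; rw [← ENNReal.rpow_one (volume Q)]
    rw [← ENNReal.rpow_add _ _ v0 v1]; congr 1; ring
  have d : ∀ f : (Fin n → ℝ) → ℝ≥0∞, ∫⁻ x in Q, f x = cubeAvg f Q * volume Q := fun f => by
    rw [cubeAvg, ENNReal.div_mul_cancel v0 v1]
  rw [d, d, ENNReal.mul_rpow_of_nonneg _ _ hr1.le, e]
  calc _ = cubeAvg w Q * (cubeAvg (fun x => w x ^ (-1 / (r - 1))) Q) ^ (r - 1) *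
          (volume Q * volume Q ^ (r - 1)) := by ring
    _ ≤ _ := by gcongr

lemma apPair_of {n : ℕ} (r : ℝ) (hr : 1 < r) (w : (Fin n → ℝ) → ℝ≥0∞) (hw : Measurable w)
    (h : ∀ x, w x ≠ 0 ∧ w x ≠ ⊤) (hA : apConst r w ≠ ⊤) :
    ApPair (r - 1) (apConst r w) w (fun x => w x ^ (-1 / (r - 1))) := by
  refine ⟨by linarith, hA, hw, by fun_prop, ?_, ?_⟩
  · intro A _
    rw [add_sub_cancel]
    exact holder_lower r hr w hw (ae_of_all _ h) A
  · intro c ρ hρ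
    rw [add_sub_cancel]
    exact cube_prod_le r hr w (isCube_iff.2 ⟨c, ρ, hρ, rfl⟩)

theorem muckenhoupt {n : ℕ} (r : ℝ) (hr : 1 < r) (w : (Fin n → ℝ) → ℝ≥0∞) (hw : Measurable w)
    (h : ∀ x, w x ≠ 0 ∧ w x ≠ ⊤) (hA : apConst r w ≠ ⊤) :
    ∃ C : ℝ≥0∞, C ≠ ⊤ ∧ ∀ u : (Fin n → ℝ) → ℝ≥0∞, Measurable u →
      ∫⁻ x, (maxOp (fun y => u y * w y) x / w x) ^ (r / (r - 1)) * w x ≤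
        C * ∫⁻ x, u x ^ (r / (r - 1)) * w x := by
  have P := apPair_of r hr w hw h hA
  have hr1 : 0 < r - 1 := by linarith
  have hrr : 1 < r / (r - 1) := by rw [one_lt_div hr1]; linarith
  have hrr0 : 0 ≤ r / (r - 1) := by linarith
  obtain ⟨C1, hC1, H1⟩ := P.strong (r / (r - 1)) hrr
  obtain ⟨C2, hC2, H2⟩ := P.symm.strong r hr
  set σ := fun x => w x ^ (-1 / (r - 1)) with hσdef
  have hσ : ∀ x, σ x ≠ 0 ∧ σ x ≠ ⊤ := fun x =>
    ⟨by simp [hσdef, ENNReal.rpow_eq_zero_iff, h x], by simp [hσdef, ENNReal.rpow_eq_top_iff, h x]⟩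
  set K := (ENNReal.ofReal (2 ^ n) * apConst r w) ^ (r / (r - 1)) with hK
  have hKt : K ≠ ⊤ := ENNReal.rpow_ne_top_of_nonneg hrr0 (ENNReal.mul_ne_top (by simp) hA)
  refine ⟨K * (C2 * C1), by finiteness, fun u hu => ?_⟩
  have hm := measurable_mMax (volume.withDensity w) u
  have ms : Measurable σ := P.ms
  calc _ ≤ ∫⁻ x, K * ((mMax (volume.withDensity σ)
      (fun y => mMax (volume.withDensity w) u y ^ (1 / (r - 1)) * (σ y)⁻¹) x) ^ r * σ x) := by
        refine lintegral_mono fun x => ?_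
        have h1 := (maxOp_le_mMax (fun y => u y * w y) x).trans
          (mul_le_mul_right (lerner P hσ u hu x) _)
        have h2 : (w x)⁻¹ ^ (r / (r - 1)) * w x = σ x := by
          rw [ENNReal.inv_rpow, ← ENNReal.rpow_neg]
          conv_lhs => enter [2]; rw [← ENNReal.rpow_one (w x)]
          rw [← ENNReal.rpow_add _ _ (h x).1 (h x).2, hσdef]
          congr 1; field_simp; ring
        rw [div_eq_mul_inv, ENNReal.mul_rpow_of_nonneg _ _ hrr0, mul_assoc, h2]
        rw [← mul_assoc K]
        gcongr
        refine (ENNReal.rpow_le_rpow h1 hrr0).trans (le_of_eq ?_)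
        rw [← mul_assoc, ENNReal.mul_rpow_of_nonneg _ _ hrr0, ← ENNReal.rpow_mul]
        congr 2; field_simp
    _ = K * ∫⁻ x, (mMax (volume.withDensity σ)
      (fun y => mMax (volume.withDensity w) u y ^ (1 / (r - 1)) * (σ y)⁻¹) x) ^ r * σ x := by
        rw [lintegral_const_mul' _ _ hKt]
    _ ≤ K * (C2 * ∫⁻ x, (mMax (volume.withDensity w) u x ^ (1 / (r - 1)) * (σ x)⁻¹) ^ r * σ x) := by
        gcongr
        exact H2 _ (by fun_prop)
    _ = K * (C2 * ∫⁻ x, mMax (volume.withDensity w) u x ^ (r / (r - 1)) * w x) := by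
        congr 2
        refine lintegral_congr fun x => ?_
        rw [ENNReal.mul_rpow_of_nonneg _ _ (by linarith), ← ENNReal.rpow_mul, mul_assoc]
        congr 1
        · congr 1; field_simp
        · rw [ENNReal.inv_rpow, ← ENNReal.rpow_neg]
          conv_lhs => enter [2]; rw [← ENNReal.rpow_one (σ x)]
          rw [← ENNReal.rpow_add _ _ (hσ x).1 (hσ x).2, hσdef]
          simp only
          rw [← ENNReal.rpow_mul]
          conv_rhs => rw [← ENNReal.rpow_one (w x)]
          congr 1; field_simp; ring
    _ ≤ K * (C2 * (C1 * ∫⁻ x, u x ^ (r / (r - 1)) * w x)) := by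
        gcongr
        exact H1 u hu
    _ = _ := by ring

lemma lt_maxOp_iff {n : ℕ} {f : (Fin n → ℝ) → ℝ≥0∞} {x : Fin n → ℝ}
    {t : ℝ≥0∞} : t < maxOp f x ↔ ∃ Q, IsCube Q ∧ x ∈ Q ∧ t < cubeAvg f Q := by
  simp only [maxOp, lt_iSup_iff, exists_prop]

lemma cubeAvg_le_maxOp {n : ℕ} (f : (Fin n → ℝ) → ℝ≥0∞) {x : Fin n → ℝ} {Q : Set (Fin n → ℝ)}
    (hQ : IsCube Q) (hx : x ∈ Q) : cubeAvg f Q ≤ maxOp f x :=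
  le_iSup_of_le Q <| le_iSup_of_le hQ <| le_iSup_of_le hx le_rfl

lemma measurable_maxOp {n : ℕ} (f : (Fin n → ℝ) → ℝ≥0∞) : Measurable (maxOp f) := by
  refine measurable_of_Ioi fun t => ?_
  refine IsOpen.measurableSet ?_
  rw [isOpen_iff_forall_mem_open]
  intro x hx
  obtain ⟨Q, hQ, hxQ, h⟩ := lt_maxOp_iff.1 hx
  obtain ⟨c, ρ, hρ, rfl⟩ := isCube_iff.1 hQ
  have hlim : Filter.Tendsto (fun k : ℝ => (∫⁻ y in Metric.closedBall c ρ, f y) /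
      (ENNReal.ofReal (k ^ n) * volume (Metric.ball c ρ))) (nhdsWithin 1 (Ioi 1))
      (nhds ((∫⁻ y in Metric.closedBall c ρ, f y) /
      (ENNReal.ofReal (1 ^ n) * volume (Metric.ball c ρ)))) := by
    refine ENNReal.Tendsto.const_div ?_ (Or.inl ?_)
    · refine ENNReal.Tendsto.mul_const ?_ (Or.inl (by simp))
      refine tendsto_nhdsWithin_of_tendsto_nhds ?_
      have : Continuous (fun k : ℝ => ENNReal.ofReal (k ^ n)) := ENNReal.continuous_ofReal.comp (by fun_prop)
      exact this.tendsto 1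
    · exact ENNReal.mul_ne_top (by simp) (vol_ball_ne_top c)
  have h' : t < (∫⁻ y in Metric.closedBall c ρ, f y) /
      (ENNReal.ofReal (1 ^ n) * volume (Metric.ball c ρ)) := by
    rw [cubeAvg, vol_cb_eq c hρ] at h
    simpa using h
  obtain ⟨k, hk, hk1⟩ := ((hlim.eventually (lt_mem_nhds h')).and self_mem_nhdsWithin).exists
  have hk1 : 1 < k := hk1
  have hk0 : 0 < k := by linarith
  have hlt : ρ < k * ρ := by nlinarith
  refine ⟨Metric.ball c (k * ρ), fun z hz => ?_, Metric.isOpen_ball, ?_⟩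
  · refine lt_of_lt_of_le hk ?_
    refine le_trans ?_ (cubeAvg_le_maxOp f (isCube_iff.2 ⟨c, k * ρ, by positivity, rfl⟩)
      (Metric.ball_subset_closedBall hz))
    rw [cubeAvg, vol_cb c hρ k hk0]
    gcongr
  · exact Metric.closedBall_subset_ball hlt hxQ

lemma maxOp_mono {n : ℕ} {f g : (Fin n → ℝ) → ℝ≥0∞} (h : ∀ᵐ x ∂(volume : Measure (Fin n → ℝ)), f x ≤ g x)
    (x : Fin n → ℝ) : maxOp f x ≤ maxOp g x := by
  refine iSup_le fun Q => iSup_le fun hQ => iSup_le fun hx => ?_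
  refine le_trans ?_ (cubeAvg_le_maxOp g hQ hx)
  unfold cubeAvg
  exact ENNReal.div_le_div_right (lintegral_mono_ae (ae_restrict_of_ae h)) _

lemma maxOp_tsum {n : ℕ} (f : ℕ → (Fin n → ℝ) → ℝ≥0∞) (hf : ∀ k, Measurable (f k))
    (x : Fin n → ℝ) : maxOp (fun y => ∑' k, f k y) x ≤ ∑' k, maxOp (f k) x := by
  refine iSup_le fun Q => iSup_le fun hQ => iSup_le fun hx => ?_
  unfold cubeAvg
  rw [lintegral_tsum (fun k => (hf k).aemeasurable), div_eq_mul_inv, ← ENNReal.tsum_mul_right]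
  exact ENNReal.tsum_le_tsum fun k => cubeAvg_le_maxOp (f k) hQ hx

lemma maxOp_const_mul {n : ℕ} (c : ℝ≥0∞) (f : (Fin n → ℝ) → ℝ≥0∞) (hf : Measurable f)
    (x : Fin n → ℝ) : maxOp (fun y => c * f y) x ≤ c * maxOp f x := by
  refine iSup_le fun Q => iSup_le fun hQ => iSup_le fun hx => ?_
  unfold cubeAvg
  rw [lintegral_const_mul _ hf, mul_div_assoc]
  exact mul_le_mul_right (cubeAvg_le_maxOp f hQ hx) _

lemma jensen_tsum (q : ℝ) (hq : 1 < q) (F : ℕ → ℝ≥0∞) :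
    (∑' k, (2:ℝ≥0∞)⁻¹ ^ k * F k) ^ q ≤ 2 ^ (q - 1) * ∑' k, (2:ℝ≥0∞)⁻¹ ^ k * F k ^ q := by
  have hq0 : 0 < q := by linarith
  have hq1 : 0 < q - 1 := by linarith
  have H := ENNReal.lintegral_mul_norm_pow_le (μ := (Measure.count : Measure ℕ))
    (f := fun k => (2:ℝ≥0∞)⁻¹ ^ k) (g := fun k => (2:ℝ≥0∞)⁻¹ ^ k * F k ^ q)
    (by fun_prop) (by fun_prop) (p := (q - 1) / q) (q := 1 / q)
    (by positivity) (by positivity) (by field_simp; ring)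
  simp only [lintegral_count] at H
  have e1 : ∀ k, ((2:ℝ≥0∞)⁻¹ ^ k) ^ ((q - 1) / q) * ((2:ℝ≥0∞)⁻¹ ^ k * F k ^ q) ^ (1 / q)
      = (2:ℝ≥0∞)⁻¹ ^ k * F k := by
    intro k
    rw [ENNReal.mul_rpow_of_nonneg _ _ (by positivity), ← mul_assoc,
      ← ENNReal.rpow_add _ _ (by simp) (by simp), ← ENNReal.rpow_mul, mul_one_div_cancel hq0.ne',
      ENNReal.rpow_one]
    have : (q - 1) / q + 1 / q = 1 := by field_simp; ring
    rw [this, ENNReal.rpow_one]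
  simp only [e1] at H
  have e2 : ∑' k : ℕ, (2:ℝ≥0∞)⁻¹ ^ k = 2 := by
    rw [ENNReal.tsum_geometric, ENNReal.one_sub_inv_two, inv_inv]
  rw [e2] at H
  have := ENNReal.rpow_le_rpow H hq0.le
  rw [ENNReal.mul_rpow_of_nonneg _ _ hq0.le, ← ENNReal.rpow_mul, ← ENNReal.rpow_mul,
    one_div_mul_cancel hq0.ne', div_mul_cancel₀ _ hq0.ne', ENNReal.rpow_one] at this
  exact this

def rdfSeq {n : ℕ} (b : ℝ≥0∞) (w u : (Fin n → ℝ) → ℝ≥0∞) : ℕ → (Fin n → ℝ) → ℝ≥0∞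
  | 0 => u
  | k + 1 => fun x => b⁻¹ * (maxOp (fun y => rdfSeq b w u k y * w y) x / w x)

theorem rdf {n : ℕ} (r : ℝ) (hr : 1 < r) (w : (Fin n → ℝ) → ℝ≥0∞) (hw : Measurable w)
    (h : ∀ x, w x ≠ 0 ∧ w x ≠ ⊤) (hA : apConst r w ≠ ⊤) :
    ∃ A K : ℝ≥0∞, A ≠ ⊤ ∧ K ≠ ⊤ ∧ ∀ u : (Fin n → ℝ) → ℝ≥0∞, Measurable u →
      ∃ R : (Fin n → ℝ) → ℝ≥0∞, Measurable R ∧ (∀ x, u x ≤ R x) ∧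
        ∫⁻ x, R x ^ (r / (r - 1)) * w x ≤ A * ∫⁻ x, u x ^ (r / (r - 1)) * w x ∧
        ∀ x, maxOp (fun y => R y * w y) x ≤ K * (R x * w x) := by
  obtain ⟨C, hC, H⟩ := muckenhoupt r hr w hw h hA
  have hr1 : 0 < r - 1 := by linarith
  have hq : 1 < r / (r - 1) := by rw [one_lt_div hr1]; linarith
  set q := r / (r - 1)
  have hq0 : 0 < q := by linarith
  set b := (C + 1) ^ (1 / q) with hb
  have hbt : b ≠ ⊤ := ENNReal.rpow_ne_top_of_nonneg (by positivity) (by finiteness)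
  have hbq : b ^ q = C + 1 := by
    rw [hb, ← ENNReal.rpow_mul, one_div_mul_cancel hq0.ne', ENNReal.rpow_one]
  have hb0 : b ≠ 0 := by
    intro h0; rw [h0, ENNReal.zero_rpow_of_pos hq0] at hbq
    exact (by simp : (C + 1) ≠ 0) hbq.symm
  have hbC : b⁻¹ ^ q * C ≤ 1 := by
    rw [ENNReal.inv_rpow, hbq]
    calc (C + 1)⁻¹ * C ≤ (C + 1)⁻¹ * (C + 1) := by gcongr; exact le_self_add
      _ ≤ 1 := ENNReal.inv_mul_le_one _
  refine ⟨2 ^ (q - 1) * 2, 2 * b, by finiteness, by finiteness, fun u hu => ?_⟩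
  set F := rdfSeq b w u with hF
  have hFs : ∀ k x, F (k + 1) x = b⁻¹ * (maxOp (fun y => F k y * w y) x / w x) := fun k x => rfl
  have mF : ∀ k, Measurable (F k) := by
    intro k
    cases k with
    | zero => exact hu
    | succ k =>
      have := measurable_maxOp (fun y => F k y * w y)
      show Measurable (fun x => b⁻¹ * (maxOp (fun y => F k y * w y) x / w x))
      fun_prop
  have nF : ∀ k, ∫⁻ x, F k x ^ q * w x ≤ ∫⁻ x, u x ^ q * w x := by
    intro k
    induction k with
    | zero => exact le_rfl
    | succ k ih =>
      refine le_trans ?_ ih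
      have hm := measurable_maxOp (fun y => F k y * w y)
      simp only [hFs, ENNReal.mul_rpow_of_nonneg _ _ hq0.le, mul_assoc]
      rw [lintegral_const_mul _ (by fun_prop)]
      calc _ ≤ b⁻¹ ^ q * (C * ∫⁻ x, F k x ^ q * w x) := by
            gcongr; exact H _ (mF k)
        _ = (b⁻¹ ^ q * C) * ∫⁻ x, F k x ^ q * w x := by ring
        _ ≤ 1 * ∫⁻ x, F k x ^ q * w x := by gcongr
        _ = _ := one_mul _
  have Fmax : ∀ k x, maxOp (fun y => F k y * w y) x = b * (F (k + 1) x * w x) := by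
    intro k x
    rw [hFs, mul_assoc, ENNReal.div_mul_cancel (h x).1 (h x).2, ← mul_assoc,
      ENNReal.mul_inv_cancel hb0 hbt, one_mul]
  refine ⟨fun x => ∑' k, (2:ℝ≥0∞)⁻¹ ^ k * F k x, ?_, ?_, ?_, ?_⟩
  · exact Measurable.tsum fun k => (mF k).const_mul _
  · intro x
    refine le_trans ?_ (ENNReal.le_tsum 0)
    simp [hF, rdfSeq]
  · calc ∫⁻ x, (∑' k, (2:ℝ≥0∞)⁻¹ ^ k * F k x) ^ q * w x
        ≤ ∫⁻ x, 2 ^ (q - 1) * ∑' k, (2:ℝ≥0∞)⁻¹ ^ k * (F k x ^ q * w x) := by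
          refine lintegral_mono fun x => ?_
          simp only [← mul_assoc ((2:ℝ≥0∞)⁻¹ ^ _)]
          rw [ENNReal.tsum_mul_right, ← mul_assoc]
          gcongr
          exact jensen_tsum q hq _
      _ = 2 ^ (q - 1) * ∑' k, (2:ℝ≥0∞)⁻¹ ^ k * ∫⁻ x, F k x ^ q * w x := by
          rw [lintegral_const_mul' _ _ (by finiteness), lintegral_tsum]
          · congr 2; ext k
            rw [lintegral_const_mul' _ _ (by finiteness)]
          · intro k
            have := mF k
            fun_prop
      _ ≤ 2 ^ (q - 1) * ∑' k, (2:ℝ≥0∞)⁻¹ ^ k * ∫⁻ x, u x ^ q * w x := by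
          refine mul_le_mul_right (ENNReal.tsum_le_tsum fun k => mul_le_mul_right (nF k) _) _
      _ = _ := by
          rw [ENNReal.tsum_mul_right, ENNReal.tsum_geometric, ENNReal.one_sub_inv_two, inv_inv,
            mul_assoc]
  · intro x
    simp only [← ENNReal.tsum_mul_right]
    refine (maxOp_tsum _ (fun k => ((mF k).const_mul _).mul hw) x).trans ?_
    calc ∑' k, maxOp (fun y => (2:ℝ≥0∞)⁻¹ ^ k * F k y * w y) x
        ≤ ∑' k, 2 * b * ((2:ℝ≥0∞)⁻¹ ^ (k + 1) * F (k + 1) x * w x) := by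
          refine ENNReal.tsum_le_tsum fun k => ?_
          simp only [mul_assoc]
          refine (maxOp_const_mul _ _ ((mF k).mul hw) x).trans (le_of_eq ?_)
          rw [show (F k * w) = fun y => F k y * w y from rfl, Fmax, pow_succ]
          calc _ = (2 * 2⁻¹) * ((2:ℝ≥0∞)⁻¹ ^ k * (b * (F (k + 1) x * w x))) := by
                rw [ENNReal.mul_inv_cancel (by simp) (by simp), one_mul]
            _ = _ := by ring
      _ ≤ _ := by
          rw [ENNReal.tsum_mul_left]
          refine mul_le_mul_right ?_ _
          rw [tsum_eq_zero_add' (f := fun k => (2:ℝ≥0∞)⁻¹ ^ k * F k x * w x) ENNReal.summable]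
          exact le_add_self

lemma cubeAvg_holder {n : ℕ} (f g : (Fin n → ℝ) → ℝ≥0∞) (hf : Measurable f) (hg : Measurable g)
    (θ : ℝ) (h0 : 0 ≤ θ) (h1 : θ ≤ 1) {Q : Set (Fin n → ℝ)} (hQ : IsCube Q) :
    cubeAvg (fun x => f x ^ θ * g x ^ (1 - θ)) Q ≤ cubeAvg f Q ^ θ * cubeAvg g Q ^ (1 - θ) := by
  obtain ⟨v0, v1, _⟩ := cube_vol hQ
  have h1' : 0 ≤ 1 - θ := by linarith
  unfold cubeAvg
  rw [ENNReal.div_rpow_of_nonneg _ _ h0, ENNReal.div_rpow_of_nonneg _ _ h1']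
  have e : volume Q = volume Q ^ θ * volume Q ^ (1 - θ) := by
    rw [← ENNReal.rpow_add _ _ v0 v1, add_sub_cancel, ENNReal.rpow_one]
  have n1 : volume Q ^ θ ≠ 0 := by simp [ENNReal.rpow_eq_zero_iff, v0, v1]
  have n2 : volume Q ^ θ ≠ ⊤ := by simp [ENNReal.rpow_eq_top_iff, v0, v1]
  conv_lhs => rw [e]
  rw [div_eq_mul_inv, div_eq_mul_inv, div_eq_mul_inv, ENNReal.mul_inv (Or.inl n1) (Or.inl n2)]
  calc _ ≤ ((∫⁻ x in Q, f x) ^ θ * (∫⁻ x in Q, g x) ^ (1 - θ)) *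
        ((volume Q ^ θ)⁻¹ * (volume Q ^ (1 - θ))⁻¹) := by
        gcongr
        exact ENNReal.lintegral_mul_norm_pow_le (by fun_prop) (by fun_prop) h0 h1' (by ring)
    _ = _ := by ring

lemma ap_interp {n : ℕ} (q r : ℝ) (hq : 1 ≤ q) (hqr : q < r) (w U : (Fin n → ℝ) → ℝ≥0∞)
    (hw : Measurable w) (hU : Measurable U) (h : ∀ x, w x ≠ 0 ∧ w x ≠ ⊤)
    (K : ℝ≥0∞) (hK : K ≠ ⊤) (hUK : ∀ x, maxOp U x ≤ K * U x) :
    apConst q (fun x => w x ^ ((q - 1) / (r - 1)) * U x ^ (1 - (q - 1) / (r - 1))) ≤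
      apConst r w ^ ((q - 1) / (r - 1)) * K ^ (1 - (q - 1) / (r - 1)) := by
  rcases hq.eq_or_lt with rfl | hq1
  · simp only [sub_self, zero_div, ENNReal.rpow_zero, sub_zero, ENNReal.rpow_one, one_mul]
    rw [apConst, if_pos rfl]
    exact sInf_le (ae_of_all _ hUK)
  have hr : 1 < r := by linarith
  have hr1 : 0 < r - 1 := by linarith
  have hq1' : 0 < q - 1 := by linarith
  have hθ0 : 0 < (q - 1) / (r - 1) := by positivity
  have hθ1 : (q - 1) / (r - 1) < 1 := by rw [div_lt_one hr1]; linarith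
  have hθs : (q - 1) / (r - 1) * (1 / (q - 1)) = 1 / (r - 1) := by field_simp
  have hθr : (r - 1) * ((q - 1) / (r - 1)) = q - 1 := by field_simp
  set θ := (q - 1) / (r - 1)
  have h1θ : 0 < 1 - θ := by linarith
  conv_lhs => rw [apConst, if_neg hq1.ne']
  refine iSup_le fun Q => iSup_le fun hQ => ?_
  obtain ⟨v0, v1, mQ⟩ := cube_vol hQ
  have H1 := cubeAvg_holder w U hw hU θ hθ0.le hθ1.le hQ
  have HU : ∀ x ∈ Q, cubeAvg U Q ≤ K * U x := fun x hx => (cubeAvg_le_maxOp U hQ hx).trans (hUK x)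
  have HA : cubeAvg w Q * (cubeAvg (fun x => w x ^ (-1 / (r - 1))) Q) ^ (r - 1) ≤ apConst r w := by
    rw [apConst, if_neg hr.ne']
    exact le_iSup₂_of_le Q hQ le_rfl
  set a := cubeAvg U Q with ha
  rcases eq_or_ne a 0 with a0 | a0
  · rw [a0, ENNReal.zero_rpow_of_pos h1θ, mul_zero] at H1
    rw [le_antisymm H1 bot_le, zero_mul]
    exact bot_le
  rcases eq_or_ne a ⊤ with at' | at'
  · have : cubeAvg (fun x => (w x ^ θ * U x ^ (1 - θ)) ^ (-1 / (q - 1))) Q = 0 := by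
      unfold cubeAvg
      rw [ENNReal.div_eq_zero_iff]
      left
      rw [setLIntegral_congr_fun mQ (g := fun _ => 0)]
      · simp
      · intro x hx
        have h2 := HU x hx
        rw [at', top_le_iff, ENNReal.mul_eq_top] at h2
        have h3 : U x = ⊤ := by
          rcases h2 with h2 | h2
          · exact h2.2
          · exact absurd h2.1 hK
        simp only [h3]
        rw [ENNReal.top_rpow_of_pos h1θ, ENNReal.mul_top, ENNReal.top_rpow_of_neg]
        · exact div_neg_of_neg_of_pos (by norm_num) hq1'
        · simp [ENNReal.rpow_eq_zero_iff, h x]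
    rw [this, ENNReal.zero_rpow_of_pos hq1', mul_zero]
    exact bot_le
  have hQne : Q.Nonempty := by
    rw [nonempty_iff_ne_empty]; rintro rfl; simp at v0
  have K0 : K ≠ 0 := by
    rintro rfl
    obtain ⟨x, hx⟩ := hQne
    have := HU x hx
    rw [zero_mul] at this
    exact a0 (le_antisymm this bot_le)
  have aK0 : a / K ≠ 0 := by simp [ENNReal.div_eq_zero_iff, a0, hK]
  have aKt : a / K ≠ ⊤ := ENNReal.div_ne_top at' K0
  have H2 : cubeAvg (fun x => (w x ^ θ * U x ^ (1 - θ)) ^ (-1 / (q - 1))) Q ≤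
      (a / K) ^ (-(1 - θ) / (q - 1)) * cubeAvg (fun x => w x ^ (-1 / (r - 1))) Q := by
    unfold cubeAvg
    rw [← mul_div_assoc, ← lintegral_const_mul _ (by fun_prop)]
    refine ENNReal.div_le_div_right ?_ _
    refine setLIntegral_mono' mQ fun x hx => ?_
    have hx1 : a / K ≤ U x := ENNReal.div_le_of_le_mul' (HU x hx)
    have hx2 : w x ^ θ * (a / K) ^ (1 - θ) ≤ w x ^ θ * U x ^ (1 - θ) := by gcongr
    calc (w x ^ θ * U x ^ (1 - θ)) ^ (-1 / (q - 1)) ≤ (w x ^ θ * (a / K) ^ (1 - θ)) ^ (-1 / (q - 1)) := by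
          rw [neg_div, ENNReal.rpow_neg, ENNReal.rpow_neg, ENNReal.inv_le_inv]
          gcongr
      _ = (a / K) ^ (-(1 - θ) / (q - 1)) * w x ^ (-1 / (r - 1)) := by
          rw [ENNReal.mul_rpow_of_ne_zero, ← ENNReal.rpow_mul, ← ENNReal.rpow_mul, mul_comm]
          · congr 2
            · ring
            · calc _ = -(θ * (1 / (q - 1))) := by ring
                _ = _ := by rw [hθs]; ring
          · simp [ENNReal.rpow_eq_zero_iff, h x]
          · simp [ENNReal.rpow_eq_zero_iff, aK0, aKt]
  set W := cubeAvg w Q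
  set S := cubeAvg (fun x => w x ^ (-1 / (r - 1))) Q
  calc _ ≤ (W ^ θ * a ^ (1 - θ)) * ((a / K) ^ (-(1 - θ) / (q - 1)) * S) ^ (q - 1) := by gcongr
    _ = (W * S ^ (r - 1)) ^ θ * (a ^ (1 - θ) * (a / K) ^ (-(1 - θ))) := by
        rw [ENNReal.mul_rpow_of_nonneg _ _ hq1'.le, ENNReal.mul_rpow_of_nonneg _ _ hθ0.le,
          ← ENNReal.rpow_mul, ← ENNReal.rpow_mul, hθr, div_mul_cancel₀ _ hq1'.ne']
        ring
    _ = (W * S ^ (r - 1)) ^ θ * K ^ (1 - θ) := by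
        congr 1
        have hak : a ^ (1 - θ) = (a / K * K) ^ (1 - θ) := by rw [ENNReal.div_mul_cancel K0 hK]
        rw [hak, ENNReal.mul_rpow_of_nonneg _ _ h1θ.le, mul_comm, ← mul_assoc,
          ← ENNReal.rpow_add _ _ aK0 aKt, neg_add_cancel, ENNReal.rpow_zero, one_mul]
    _ ≤ _ := by gcongr

lemma le_mul_sInf {ρ b : ℝ≥0∞} {S : Set ℝ≥0∞} (hρ0 : ρ ≠ 0) (hρ : ρ ≠ ⊤)
    (h : ∀ C ∈ S, b ≤ ρ * C) : b ≤ ρ * sInf S := by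
  have : b / ρ ≤ sInf S := le_sInf fun C hC => ENNReal.div_le_of_le_mul' (h C hC)
  calc b = ρ * (b / ρ) := (ENNReal.mul_div_cancel hρ0 hρ).symm
    _ ≤ _ := by gcongr

/-- Comparable weights have comparable constants. -/
lemma apConst_le_of_le {n : ℕ} (q : ℝ) (hq : 1 ≤ q) (v v' : (Fin n → ℝ) → ℝ≥0∞)
    (hv : Measurable v) (hv' : Measurable v') (ρ : ℝ≥0∞) (hρ0 : ρ ≠ 0) (hρ : ρ ≠ ⊤)
    (h1 : ∀ x, v x ≤ v' x) (h2 : ∀ x, v' x ≤ ρ * v x) :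
    apConst q v' ≤ ρ * apConst q v ∧ apConst q v ≤ ρ * apConst q v' := by
  rcases hq.eq_or_lt with rfl | hq1
  · simp only [apConst, if_pos]
    constructor
    · refine le_mul_sInf hρ0 hρ fun C hC => sInf_le ?_
      simp only [mem_ofPred_eq] at hC ⊢
      filter_upwards [hC] with x hx
      calc maxOp v' x ≤ ρ * maxOp v x :=
            (maxOp_mono (ae_of_all _ h2) x).trans (maxOp_const_mul _ _ hv x)
        _ ≤ ρ * (C * v' x) := by
            gcongr
            exact hx.trans (by gcongr; exact h1 x)
        _ = _ := by ring
    · refine le_mul_sInf hρ0 hρ fun C hC => sInf_le ?_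
      simp only [mem_ofPred_eq] at hC ⊢
      filter_upwards [hC] with x hx
      calc maxOp v x ≤ maxOp v' x := maxOp_mono (ae_of_all _ h1) x
        _ ≤ C * (ρ * v x) := hx.trans (by gcongr; exact h2 x)
        _ = _ := by ring
  · have hq1' : 0 < q - 1 := by linarith
    have hs : -1 / (q - 1) ≤ 0 := (div_neg_of_neg_of_pos (by norm_num) hq1').le
    simp only [apConst, if_neg hq1.ne']
    have anti : ∀ a b : ℝ≥0∞, a ≤ b → b ^ (-1 / (q - 1)) ≤ a ^ (-1 / (q - 1)) := by
      intro a b hab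
      rw [neg_div, ENNReal.rpow_neg, ENNReal.rpow_neg, ENNReal.inv_le_inv]
      exact ENNReal.rpow_le_rpow hab (by positivity)
    have A1 : ∀ Q, cubeAvg v' Q ≤ ρ * cubeAvg v Q := by
      intro Q
      unfold cubeAvg
      rw [← mul_div_assoc, ← lintegral_const_mul _ hv]
      exact ENNReal.div_le_div_right (lintegral_mono h2) _
    have A2 : ∀ Q, cubeAvg v Q ≤ cubeAvg v' Q := fun Q =>
      ENNReal.div_le_div_right (lintegral_mono h1) _
    have A3 : ∀ Q, cubeAvg (fun x => v' x ^ (-1 / (q - 1))) Q ≤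
        cubeAvg (fun x => v x ^ (-1 / (q - 1))) Q := fun Q =>
      ENNReal.div_le_div_right (lintegral_mono fun x => anti _ _ (h1 x)) _
    have A4 : ∀ Q, cubeAvg (fun x => v x ^ (-1 / (q - 1))) Q ≤
        ρ ^ (1 / (q - 1)) * cubeAvg (fun x => v' x ^ (-1 / (q - 1))) Q := by
      intro Q
      unfold cubeAvg
      rw [← mul_div_assoc, ← lintegral_const_mul _ (by fun_prop)]
      refine ENNReal.div_le_div_right (lintegral_mono fun x => ?_) _
      have : ρ⁻¹ * v' x ≤ v x := by
        rw [mul_comm, ← div_eq_mul_inv]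
        exact ENNReal.div_le_of_le_mul' (h2 x)
      refine (anti _ _ this).trans (le_of_eq ?_)
      have hs' : 0 ≤ 1 / (q - 1) := by positivity
      rw [neg_div, ENNReal.rpow_neg, ENNReal.rpow_neg, ENNReal.mul_rpow_of_nonneg _ _ hs',
        ENNReal.inv_rpow, ENNReal.mul_inv, inv_inv]
      · left; simp [ENNReal.rpow_eq_top_iff, hρ0, hρ]
      · left; simp [ENNReal.rpow_eq_zero_iff, hρ0, hρ]
    constructor
    · rw [ENNReal.mul_iSup]
      refine iSup_mono fun Q => ?_
      rw [ENNReal.mul_iSup]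
      refine iSup_mono fun hQ => ?_
      rw [← mul_assoc]
      gcongr
      · exact A1 Q
      · exact A3 Q
    · rw [ENNReal.mul_iSup]
      refine iSup_mono fun Q => ?_
      rw [ENNReal.mul_iSup]
      refine iSup_mono fun hQ => ?_
      calc _ ≤ cubeAvg v' Q * (ρ ^ (1 / (q - 1)) * cubeAvg (fun x => v' x ^ (-1 / (q - 1))) Q) ^ (q - 1) := by
            gcongr
            · exact A2 Q
            · exact A4 Q
        _ = _ := by
            rw [ENNReal.mul_rpow_of_nonneg _ _ hq1'.le, ← ENNReal.rpow_mul,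
              one_div_mul_cancel hq1'.ne', ENNReal.rpow_one]
            ring

lemma cubeAvg_const {n : ℕ} (c : ℝ≥0∞) {Q : Set (Fin n → ℝ)} (hQ : IsCube Q) :
    cubeAvg (fun _ => c) Q = c := by
  obtain ⟨v0, v1, mQ⟩ := cube_vol hQ
  unfold cubeAvg
  rw [setLIntegral_const, ENNReal.mul_div_cancel_right v0 v1]

lemma exists_cube {n : ℕ} (x : Fin n → ℝ) : ∃ Q, IsCube Q ∧ x ∈ Q :=
  ⟨Metric.closedBall x 1, isCube_iff.2 ⟨x, 1, one_pos, rfl⟩, Metric.mem_closedBall_self one_pos.le⟩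

lemma maxOp_const {n : ℕ} (c : ℝ≥0∞) (x : Fin n → ℝ) : maxOp (fun _ => c) x = c := by
  apply le_antisymm
  · unfold maxOp
    refine iSup_le fun Q => iSup_le fun hQ => iSup_le fun _ => ?_
    rw [cubeAvg_const c hQ]
  · obtain ⟨Q, hQ, hx⟩ := exists_cube x
    calc c = cubeAvg (fun _ => c) Q := (cubeAvg_const c hQ).symm
      _ ≤ _ := cubeAvg_le_maxOp _ hQ hx

lemma apConst_const {n : ℕ} (q : ℝ) (hq : 1 ≤ q) (c : ℝ≥0∞) (c0 : c ≠ 0) (c1 : c ≠ ⊤) :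
    apConst q (fun _ : Fin n → ℝ => c) = 1 := by
  rcases hq.eq_or_lt with rfl | hq1
  · simp only [apConst, if_pos, maxOp_const]
    have : {C : ℝ≥0∞ | ∀ᵐ x ∂(volume : Measure (Fin n → ℝ)), c ≤ C * c} = Ici 1 := by
      ext C
      simp only [mem_ofPred_eq, mem_Ici, Filter.eventually_const]
      nth_rewrite 1 [← one_mul c]
      exact ENNReal.mul_le_mul_iff_left c0 c1
    rw [this]
    exact csInf_Ici
  · have hq1' : 0 < q - 1 := by linarith
    simp only [apConst, if_neg hq1.ne']
    have key : ∀ Q : Set (Fin n → ℝ), IsCube Q → cubeAvg (fun _ => c) Q *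
        (cubeAvg (fun _ : Fin n → ℝ => c ^ (-1 / (q - 1))) Q) ^ (q - 1) = 1 := by
      intro Q hQ
      rw [cubeAvg_const _ hQ, cubeAvg_const _ hQ, ← ENNReal.rpow_mul, div_mul_cancel₀ _ hq1'.ne',
        ENNReal.rpow_neg, ENNReal.rpow_one, ENNReal.mul_inv_cancel c0 c1]
    apply le_antisymm
    · refine iSup_le fun Q => iSup_le fun hQ => (key Q hQ).le
    · obtain ⟨Q, hQ, -⟩ := exists_cube (0 : Fin n → ℝ)
      exact (key Q hQ).ge.trans (le_iSup₂_of_le Q hQ le_rfl)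

/-- tuned weight -/
def tuneW {n : ℕ} (E : Set (Fin n → ℝ)) (v : (Fin n → ℝ) → ℝ≥0∞) (t : ℝ≥0∞) (x : Fin n → ℝ) : ℝ≥0∞ :=
  v x * (1 + E.indicator (fun _ => t) x)

lemma measurable_tuneW {n : ℕ} {E : Set (Fin n → ℝ)} (hE : MeasurableSet E)
    {v : (Fin n → ℝ) → ℝ≥0∞} (hv : Measurable v) (t : ℝ≥0∞) : Measurable (tuneW E v t) := by
  unfold tuneW
  exact hv.mul (Measurable.const_add (measurable_const.indicator hE) 1)

lemma tune_lower {n : ℕ} (hn : 0 < n) (q : ℝ) (hq : 1 ≤ q) (K : ℝ≥0∞) (hK : K ≠ ⊤) :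
    ∃ (E : Set (Fin n → ℝ)) (c D : ℝ≥0∞), MeasurableSet E ∧ c ≠ 0 ∧ c ≠ ⊤ ∧ D ≠ 0 ∧ D ≠ ⊤ ∧
      ∀ v : (Fin n → ℝ) → ℝ≥0∞, Measurable v → (∀ᵐ x, v x ≠ 0 ∧ v x ≠ ⊤) → apConst q v ≤ K →
        ∀ t : ℝ≥0∞, t * c ≤ D * apConst q (tuneW E v t) := by
  set E : Set (Fin n → ℝ) := Metric.closedBall (fun _ => 1/4) (1/8) with hE
  set F : Set (Fin n → ℝ) := Metric.closedBall (fun _ => 3/4) (1/8) with hF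
  set Q : Set (Fin n → ℝ) := Metric.closedBall (fun _ => 1/2) (1/2) with hQ
  have cE : IsCube E := isCube_iff.2 ⟨_, _, by norm_num, rfl⟩
  have cF : IsCube F := isCube_iff.2 ⟨_, _, by norm_num, rfl⟩
  have cQ : IsCube Q := isCube_iff.2 ⟨_, _, by norm_num, rfl⟩
  obtain ⟨E0, E1, mE⟩ := cube_vol cE
  obtain ⟨F0, F1, mF⟩ := cube_vol cF
  obtain ⟨Q0, Q1, mQ⟩ := cube_vol cQ
  have EQ : E ⊆ Q := by
    intro x hx
    rw [hE, Metric.mem_closedBall, dist_pi_le_iff (by norm_num)] at hx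
    rw [hQ, Metric.mem_closedBall, dist_pi_le_iff (by norm_num)]
    intro i
    have := hx i
    rw [Real.dist_eq, abs_le] at this ⊢
    constructor <;> linarith
  have FQ : F ⊆ Q := by
    intro x hx
    rw [hF, Metric.mem_closedBall, dist_pi_le_iff (by norm_num)] at hx
    rw [hQ, Metric.mem_closedBall, dist_pi_le_iff (by norm_num)]
    intro i
    have := hx i
    rw [Real.dist_eq, abs_le] at this ⊢
    constructor <;> linarith
  have FE : ∀ x ∈ F, x ∉ E := by
    intro x hx hx'
    rw [hE, Metric.mem_closedBall, dist_pi_le_iff (by norm_num)] at hx'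
    rw [hF, Metric.mem_closedBall, dist_pi_le_iff (by norm_num)] at hx
    have h1 := hx ⟨0, hn⟩
    have h2 := hx' ⟨0, hn⟩
    rw [Real.dist_eq, abs_le] at h1 h2
    linarith [h1.1, h2.2]
  clear_value E F Q
  have low : ∀ (v : (Fin n → ℝ) → ℝ≥0∞), Measurable v → ∀ t, t * ∫⁻ x in E, v x ≤ ∫⁻ x in Q, tuneW E v t x := by
    intro v hv t
    rw [← lintegral_const_mul _ hv]
    calc ∫⁻ x in E, t * v x ≤ ∫⁻ x in E, tuneW E v t x := by
          refine setLIntegral_mono' mE fun x hx => ?_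
          rw [tuneW, indicator_of_mem hx, mul_comm]
          gcongr
          exact le_add_self
      _ ≤ _ := lintegral_mono_set EQ
  have onF : ∀ (v : (Fin n → ℝ) → ℝ≥0∞) (t), ∀ x ∈ F, tuneW E v t x = v x := by
    intro v t x hx
    rw [tuneW, indicator_of_notMem (FE x hx), add_zero, mul_one]
  rcases hq.eq_or_lt with rfl | hq1
  · refine ⟨E, volume E * volume F, (K + 1) * volume Q ^ 2, mE, mul_ne_zero E0 F0,
      ENNReal.mul_ne_top E1 F1, by simp [Q0], by finiteness, fun v hv h0 hvK t => ?_⟩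
    have vQ0 : ∫⁻ x in Q, v x ≠ 0 := by
      intro h
      rw [setLIntegral_eq_zero_iff mQ hv] at h
      apply Q0
      rw [measure_eq_zero_iff_ae_notMem]
      filter_upwards [h, h0] with x hx hx' hxQ
      exact hx'.1 (hx hxQ)
    have : ∃ C, C ≤ K + 1 ∧ ∀ᵐ x, maxOp v x ≤ C * v x := by
      have : apConst 1 v < K + 1 := hvK.trans_lt (ENNReal.lt_add_right hK one_ne_zero)
      simp only [apConst, if_pos] at this
      obtain ⟨C, hC, hC'⟩ := sInf_lt_iff.1 this
      exact ⟨C, hC'.le, hC⟩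
    obtain ⟨C₀, hC₀, HC₀⟩ := this
    have int : ∀ (u : (Fin n → ℝ) → ℝ≥0∞) C, Measurable u → (∀ᵐ x, maxOp u x ≤ C * u x) → ∀ G,
        MeasurableSet G → G ⊆ Q →
        (∫⁻ x in Q, u x) / volume Q * volume G ≤ C * ∫⁻ x in G, u x := by
      intro u C hu hC G mG hG
      rw [← setLIntegral_const, ← lintegral_const_mul _ hu]
      refine setLIntegral_mono_ae' mG ?_
      filter_upwards [hC] with x hx hxG
      exact (cubeAvg_le_maxOp u cQ (hG hxG)).trans hx
    have vQt : ∫⁻ x in Q, v x ≠ ⊤ := by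
      intro h
      apply Q0
      rw [measure_eq_zero_iff_ae_notMem]
      filter_upwards [HC₀, h0] with x hx hx' hxQ
      have h2 := (cubeAvg_le_maxOp v cQ hxQ).trans hx
      rw [cubeAvg, h, ENNReal.top_div_of_ne_top Q1, top_le_iff] at h2
      exact ENNReal.mul_ne_top (ne_top_of_le_ne_top (by finiteness) hC₀) hx'.2 h2
    simp only [apConst, if_pos]
    refine le_mul_sInf (by simp [Q0]) (by finiteness) fun C hC => ?_
    have I1 := int v C₀ hv HC₀ E mE EQ
    have I2 := int _ C (measurable_tuneW mE hv t) hC F mF FQ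
    rw [setLIntegral_congr_fun mF (onF v t)] at I2
    have dc : ∀ a : ℝ≥0∞, a / volume Q * volume Q = a := fun a => ENNReal.div_mul_cancel Q0 Q1
    rw [← ENNReal.mul_le_mul_iff_left vQ0 vQt]
    calc t * (volume E * volume F) * ∫⁻ x in Q, v x
        = t * ((∫⁻ x in Q, v x) / volume Q * volume E) * (volume F * volume Q) := by
          nth_rewrite 1 [← dc (∫⁻ x in Q, v x)]; ring
      _ ≤ t * ((K + 1) * ∫⁻ x in E, v x) * (volume F * volume Q) := by
          refine mul_le_mul_left (mul_le_mul_right (I1.trans ?_) _) _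
          exact mul_le_mul_left hC₀ _
      _ = (K + 1) * (t * ∫⁻ x in E, v x) * (volume F * volume Q) := by ring
      _ ≤ (K + 1) * (∫⁻ x in Q, tuneW E v t x) * (volume F * volume Q) := by
          refine mul_le_mul_left (mul_le_mul_right (low v hv t) _) _
      _ = (K + 1) * ((∫⁻ x in Q, tuneW E v t x) / volume Q * volume F) * volume Q ^ 2 := by
          nth_rewrite 1 [← dc (∫⁻ x in Q, tuneW E v t x)]; ring
      _ ≤ (K + 1) * (C * ∫⁻ x in F, v x) * volume Q ^ 2 := by
          refine mul_le_mul_left (mul_le_mul_right I2 _) _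
      _ ≤ (K + 1) * (C * ∫⁻ x in Q, v x) * volume Q ^ 2 := by
          refine mul_le_mul_left (mul_le_mul_right (mul_le_mul_right (lintegral_mono_set FQ) _) _) _
      _ = _ := by ring
  · have hq1' : 0 < q - 1 := by linarith
    refine ⟨E, volume E ^ q * volume F ^ q, (K + 1) * (volume Q ^ q * volume Q ^ q), mE, ?_, ?_, ?_, ?_,
      fun v hv h0 hvK t => ?_⟩
    · simp [ENNReal.rpow_eq_zero_iff, E0, F0, E1, F1]
    · exact ENNReal.mul_ne_top (ENNReal.rpow_ne_top_of_nonneg (by linarith) E1)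
        (ENNReal.rpow_ne_top_of_nonneg (by linarith) F1)
    · simp [ENNReal.rpow_eq_zero_iff, Q0, Q1]
    · have := ENNReal.rpow_ne_top_of_nonneg (x := volume Q) (y := q) (by linarith) Q1
      finiteness
    set σ : (Fin n → ℝ) → ℝ≥0∞ := fun x => v x ^ (-1 / (q - 1)) with hσ
    have HE := holder_lower q hq1 v hv h0 E
    have HF := holder_lower q hq1 v hv h0 F
    have HQ := cube_prod_le q hq1 v cQ
    have HQt := cube_prod_le q hq1 (tuneW E v t) cQ
    have sF : ∫⁻ x in F, v x ^ (-1 / (q - 1)) ≤ ∫⁻ x in Q, tuneW E v t x ^ (-1 / (q - 1)) := by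
      refine le_trans (le_of_eq ?_) (lintegral_mono_set FQ)
      refine setLIntegral_congr_fun mF fun x hx => ?_
      simp only [onF v t x hx]
    calc t * (volume E ^ q * volume F ^ q)
        ≤ t * (((∫⁻ x in E, v x) * (∫⁻ x in E, v x ^ (-1 / (q - 1))) ^ (q - 1)) *
          ((∫⁻ x in F, v x) * (∫⁻ x in F, v x ^ (-1 / (q - 1))) ^ (q - 1))) := by
          refine mul_le_mul_right (mul_le_mul' HE HF) _
      _ ≤ t * (((∫⁻ x in E, v x) * (∫⁻ x in Q, v x ^ (-1 / (q - 1))) ^ (q - 1)) *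
          ((∫⁻ x in Q, v x) * (∫⁻ x in F, v x ^ (-1 / (q - 1))) ^ (q - 1))) := by
          refine mul_le_mul_right (mul_le_mul' (mul_le_mul_right (ENNReal.rpow_le_rpow ?_ hq1'.le) _)
            (mul_le_mul_left ?_ _)) _
          · exact lintegral_mono_set EQ
          · exact lintegral_mono_set FQ
      _ = ((∫⁻ x in Q, v x) * (∫⁻ x in Q, v x ^ (-1 / (q - 1))) ^ (q - 1)) *
          ((t * ∫⁻ x in E, v x) * (∫⁻ x in F, v x ^ (-1 / (q - 1))) ^ (q - 1)) := by ring
      _ ≤ ((K + 1) * volume Q ^ q) * ((∫⁻ x in Q, tuneW E v t x) *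
            (∫⁻ x in Q, tuneW E v t x ^ (-1 / (q - 1))) ^ (q - 1)) := by
          refine mul_le_mul' (HQ.trans (mul_le_mul_left (hvK.trans le_self_add) _)) (mul_le_mul' (low v hv t)
            (ENNReal.rpow_le_rpow sF hq1'.le))
      _ ≤ ((K + 1) * volume Q ^ q) * (apConst q (tuneW E v t) * volume Q ^ q) :=
          mul_le_mul_right HQt _
      _ = _ := by ring

lemma tune {n : ℕ} (q : ℝ) (hq : 1 ≤ q) (K : ℝ≥0∞) (hK : K ≠ ⊤) (φ : ℝ≥0∞ → ℝ≥0∞)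
    (hφ : ∀ a, a ≠ ⊤ → φ a ≠ ⊤) :
    ∃ Ψ A : ℝ≥0∞, Ψ ≠ ⊤ ∧ A ≠ ⊤ ∧ ∀ v : (Fin n → ℝ) → ℝ≥0∞, Measurable v →
      (∀ᵐ x, v x ≠ 0 ∧ v x ≠ ⊤) → apConst q v ≤ K →
      ∃ v' : (Fin n → ℝ) → ℝ≥0∞, Measurable v' ∧ (∀ x, v x ≤ v' x) ∧ (∀ x, v' x ≤ A * v x) ∧
        apConst q v' < ⊤ ∧ φ (apConst q v') ≤ Ψ := by
  rcases Nat.eq_zero_or_pos n with rfl | hn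
  · refine ⟨φ 1, 1, hφ 1 one_ne_top, one_ne_top, fun v hv h0 _ => ⟨v, hv, fun _ => le_rfl,
      fun x => by rw [one_mul], ?_⟩⟩
    obtain ⟨x, hx⟩ := h0.exists
    have : v = fun _ => v x := by
      ext y; rw [Subsingleton.elim y x]
    rw [this, apConst_const q hq _ hx.1 hx.2]
    simp
  obtain ⟨E, c, D, mE, c0, c1, D0, D1, H⟩ := tune_lower hn q hq K hK
  set k : ℝ := K.toReal with hk
  have hk0 : 0 ≤ k := ENNReal.toReal_nonneg
  set ts : ℝ := ((K + 1) * D / c).toReal with hts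
  have hts' : ENNReal.ofReal ts = (K + 1) * D / c :=
    ENNReal.ofReal_toReal (ENNReal.div_ne_top (by finiteness) c0)
  have ts0 : 0 ≤ ts := ENNReal.toReal_nonneg
  refine ⟨φ (K + 1), ENNReal.ofReal (1 + ts), hφ _ (by finiteness), by finiteness,
    fun v hv h0 hvK => ?_⟩
  have mt := fun t => measurable_tuneW mE hv t
  have comp : ∀ s t : ℝ, 0 ≤ s → s ≤ t → (∀ x, tuneW E v (.ofReal s) x ≤ tuneW E v (.ofReal t) x) ∧
      (∀ x, tuneW E v (.ofReal t) x ≤ ENNReal.ofReal ((1 + t) / (1 + s)) * tuneW E v (.ofReal s) x) := by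
    intro s t hs hst
    have ht : 0 ≤ t := hs.trans hst
    constructor
    · intro x
      unfold tuneW
      by_cases hx : x ∈ E
      · simp only [indicator_of_mem hx]; gcongr
      · simp only [indicator_of_notMem hx]; rfl
    · intro x
      unfold tuneW
      by_cases hx : x ∈ E
      · simp only [indicator_of_mem hx]
        rw [← ENNReal.ofReal_one, ← ENNReal.ofReal_add (by norm_num) (by linarith),
          ← ENNReal.ofReal_add (by norm_num) hs, mul_left_comm, ← ENNReal.ofReal_mul (by positivity),
          div_mul_cancel₀ _ (by positivity)]
      · simp only [indicator_of_notMem hx, add_zero, mul_one]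
        have : 1 ≤ ENNReal.ofReal ((1 + t) / (1 + s)) := by
          rw [← ENNReal.ofReal_one]
          apply ENNReal.ofReal_le_ofReal
          rw [le_div_iff₀ (by positivity)]; linarith
        calc v x = 1 * v x := (one_mul _).symm
          _ ≤ _ := by gcongr
  have t00 : tuneW E v (.ofReal 0) = v := by
    ext x; simp [tuneW]
  have ap : ∀ s t : ℝ, 0 ≤ s → s ≤ t →
      apConst q (tuneW E v (.ofReal t)) ≤ ENNReal.ofReal ((1 + t) / (1 + s)) * apConst q (tuneW E v (.ofReal s)) ∧
      apConst q (tuneW E v (.ofReal s)) ≤ ENNReal.ofReal ((1 + t) / (1 + s)) * apConst q (tuneW E v (.ofReal t)) := by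
    intro s t hs hst
    refine apConst_le_of_le q hq _ _ (mt _) (mt _) _ ?_ ENNReal.ofReal_ne_top (comp s t hs hst).1 (comp s t hs hst).2
    rw [← pos_iff_ne_zero, ENNReal.ofReal_pos]
    have : 0 ≤ t := hs.trans hst
    positivity
  have fin : ∀ t : ℝ, 0 ≤ t → apConst q (tuneW E v (.ofReal t)) ≠ ⊤ := by
    intro t ht
    have := (ap 0 t le_rfl ht).1
    rw [t00] at this
    exact ne_top_of_le_ne_top (ENNReal.mul_ne_top ENNReal.ofReal_ne_top (ne_top_of_le_ne_top hK hvK)) this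
  set a : ℝ → ℝ := fun t => (apConst q (tuneW E v (.ofReal t))).toReal with ha
  have ap' : ∀ s t : ℝ, 0 ≤ s → s ≤ t → a t ≤ (1 + t) / (1 + s) * a s ∧ a s ≤ (1 + t) / (1 + s) * a t := by
    intro s t hs hst
    have ht : 0 ≤ t := hs.trans hst
    have hρ : 0 ≤ (1 + t) / (1 + s) := by positivity
    have h := ap s t hs hst
    constructor
    · have := ENNReal.toReal_mono (ENNReal.mul_ne_top ENNReal.ofReal_ne_top (fin s hs)) h.1
      rwa [ENNReal.toReal_mul, ENNReal.toReal_ofReal hρ] at this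
    · have := ENNReal.toReal_mono (ENNReal.mul_ne_top ENNReal.ofReal_ne_top (fin t ht)) h.2
      rwa [ENNReal.toReal_mul, ENNReal.toReal_ofReal hρ] at this
  have a0 : a 0 ≤ k := by
    simp only [ha, t00]
    exact ENNReal.toReal_mono hK hvK
  have apos : ∀ t, 0 ≤ a t := fun t => ENNReal.toReal_nonneg
  have abd : ∀ t, 0 ≤ t → t ≤ ts → a t ≤ (1 + ts) * k := by
    intro t ht htt
    have h2 := (ap' 0 t le_rfl ht).1
    rw [add_zero, div_one] at h2
    exact h2.trans (by gcongr)
  have lip : ∀ s t : ℝ, 0 ≤ s → s ≤ t → t ≤ ts → |a t - a s| ≤ (1 + ts) * k * (t - s) := by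
    intro s t hs hst htt
    have h := ap' s t hs hst
    have e : (1 + t) / (1 + s) = 1 + (t - s) / (1 + s) := by field_simp; ring
    have e2 : (t - s) / (1 + s) ≤ t - s := div_le_self (by linarith) (by linarith)
    have e3 : 0 ≤ (t - s) / (1 + s) := div_nonneg (by linarith) (by linarith)
    rw [e] at h
    have b1 := abd s hs (hst.trans htt)
    have b2 := abd t (hs.trans hst) htt
    have p1 : (t - s) / (1 + s) * a s ≤ (t - s) * ((1 + ts) * k) :=
      mul_le_mul e2 b1 (apos s) (by linarith)
    have p2 : (t - s) / (1 + s) * a t ≤ (t - s) * ((1 + ts) * k) :=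
      mul_le_mul e2 b2 (apos t) (by linarith)
    rw [abs_le]
    constructor <;> linarith [h.1, h.2]
  have cont : ContinuousOn a (Icc 0 ts) := by
    have hB : 0 ≤ (1 + ts) * k := by positivity
    have : LipschitzOnWith (Real.toNNReal ((1 + ts) * k)) a (Icc 0 ts) := by
      refine LipschitzOnWith.of_dist_le_mul fun s hs t ht => ?_
      rw [Real.coe_toNNReal _ hB, Real.dist_eq, Real.dist_eq]
      rcases le_total s t with h | h
      · rw [abs_sub_comm, abs_sub_comm s t, abs_of_nonneg (sub_nonneg.2 h)]
        exact lip s t hs.1 h ht.2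
      · rw [abs_of_nonneg (sub_nonneg.2 h)]
        exact lip t s ht.1 h hs.2
    exact this.continuousOn
  have ats : k + 1 ≤ a ts := by
    have h := H v hv h0 hvK (ENNReal.ofReal ts)
    nth_rewrite 1 [hts'] at h
    rw [ENNReal.div_mul_cancel c0 c1, mul_comm, ENNReal.mul_le_mul_iff_right D0 D1] at h
    have := ENNReal.toReal_mono (fin ts ts0) h
    rwa [ENNReal.toReal_add hK one_ne_top, ENNReal.toReal_one] at this
  obtain ⟨t, ht, hat⟩ := intermediate_value_Icc ts0 cont ⟨(by linarith : a 0 ≤ k + 1), ats⟩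
  have hval : apConst q (tuneW E v (.ofReal t)) = K + 1 := by
    rw [← ENNReal.toReal_eq_toReal_iff' (fin t ht.1) (by finiteness),
      ENNReal.toReal_add hK one_ne_top, ENNReal.toReal_one]
    exact hat
  refine ⟨_, mt (.ofReal t), fun x => ?_, fun x => ?_, (fin t ht.1).lt_top, by rw [hval]⟩
  · have := (comp 0 t le_rfl ht.1).1 x
    rwa [t00] at this
  · have := (comp 0 t le_rfl ht.1).2 x
    rw [t00, add_zero, div_one] at this
    refine this.trans ?_
    gcongr
    exact ht.2

lemma maxOp_eq_zero {n : ℕ} (U : (Fin n → ℝ) → ℝ≥0∞) (x : Fin n → ℝ)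
    (h : maxOp U x = 0) : ∫⁻ y, U y = 0 := by
  have key : ∀ k : ℕ, (volume.withDensity U) (Metric.closedBall x k) = 0 := by
    intro k
    have hQ : IsCube (Metric.closedBall x ((k:ℝ)+1)) := isCube_iff.2 ⟨_, _, by positivity, rfl⟩
    obtain ⟨v0, v1, mQ⟩ := cube_vol hQ
    have h2 := cubeAvg_le_maxOp U hQ (Metric.mem_closedBall_self (by positivity))
    rw [h, nonpos_iff_eq_zero, cubeAvg, ENNReal.div_eq_zero_iff] at h2
    rcases h2 with h2 | h2
    · refine measure_mono_null (t := Metric.closedBall x ((k:ℝ)+1)) ?_ ?_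
      · exact Metric.closedBall_subset_closedBall (by linarith)
      · rw [withDensity_apply _ mQ, h2]
    · exact absurd h2 v1
  have h3 := measure_iUnion_null key
  rw [Metric.iUnion_closedBall_nat, withDensity_apply _ MeasurableSet.univ] at h3
  simpa using h3

/-- pointwise lower bound for the constructed weight -/
lemma weight_lower (q r p : ℝ) (hq : 1 ≤ q) (hqr : q < r) (hp : 1 / p = 1 / q + 1 / r)
    (a b R v : ℝ≥0∞) (a0 : a ≠ 0) (a1 : a ≠ ⊤) (b0 : b ≠ 0) (b1 : b ≠ ⊤)
    (hR : a ^ (-((r - 1) / (2 * r))) * b ^ ((r - 1) / (2 * r)) ≤ R)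
    (hv : a * R ^ ((r - q) / (r - 1)) ≤ v) :
    a ^ ((1:ℝ)/2) * b ^ ((1:ℝ)/2) ≤ v ^ (p / q) * b ^ (p / r) := by
  have hr : 0 < r := by linarith
  have hq0 : 0 < q := by linarith
  have hr1 : 0 < r - 1 := by linarith
  have hpe : p = q * r / (q + r) := by
    have : p = 1 / (1 / p) := by simp
    rw [this, hp]; field_simp; ring
  have hp0 : 0 < p := by rw [hpe]; positivity
  have hv2 : a ^ ((r + q) / (2 * r)) * b ^ ((r - q) / (2 * r)) ≤ v := by
    refine le_trans (le_trans (le_of_eq ?_) (mul_le_mul_right (ENNReal.rpow_le_rpow hR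
      (div_nonneg (by linarith) hr1.le : 0 ≤ (r - q) / (r - 1))) a)) hv
    rw [ENNReal.mul_rpow_of_nonneg _ _ (div_nonneg (by linarith) hr1.le : 0 ≤ (r - q) / (r - 1)), ← mul_assoc,
      ← ENNReal.rpow_mul, ← ENNReal.rpow_mul]
    nth_rewrite 2 [← ENNReal.rpow_one a]
    rw [← ENNReal.rpow_add _ _ a0 a1]
    congr 2
    · field_simp; ring
    · field_simp
  refine le_trans (le_of_eq ?_) (mul_le_mul_left (ENNReal.rpow_le_rpow hv2 (by positivity : 0 ≤ p / q)) _)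
  rw [ENNReal.mul_rpow_of_nonneg _ _ (by positivity : 0 ≤ p / q), mul_assoc,
      ← ENNReal.rpow_mul, ← ENNReal.rpow_mul, ← ENNReal.rpow_add _ _ b0 b1]
  congr 2
  · rw [hpe]; field_simp; ring
  · rw [hpe]; field_simp; ring

lemma holder_weight {n : ℕ} (q r : ℝ) (hq : 1 ≤ q) (hqr : q < r)
    (w R f : (Fin n → ℝ) → ℝ≥0∞) (hw : Measurable w) (hR : Measurable R) (hf : Measurable f)
    (h : ∀ x, w x ≠ 0 ∧ w x ≠ ⊤) :
    stNorm q (fun x => w x * R x ^ ((r - q) / (r - 1))) f ≤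
      stNorm r w f * (∫⁻ x, R x ^ (r / (r - 1)) * w x) ^ (1 / q - 1 / r) := by
  have hr : 0 < r := by linarith
  have hq0 : 0 < q := by linarith
  have hr1 : 0 < r - 1 := by linarith
  have hqr' : 0 < q / r := by positivity
  have hqr1 : 0 ≤ 1 - q / r := by
    rw [sub_nonneg, div_le_one hr]; exact hqr.le
  unfold stNorm
  have H := ENNReal.lintegral_mul_norm_pow_le (μ := volume) (f := fun x => f x ^ r * w x)
    (g := fun x => R x ^ (r / (r - 1)) * w x) (by fun_prop) (by fun_prop) hqr'.le hqr1 (by ring)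
  have e : ∀ x, (f x ^ r * w x) ^ (q / r) * (R x ^ (r / (r - 1)) * w x) ^ (1 - q / r) =
      f x ^ q * (w x * R x ^ ((r - q) / (r - 1))) := by
    intro x
    rw [ENNReal.mul_rpow_of_nonneg _ _ hqr'.le, ENNReal.mul_rpow_of_nonneg _ _ hqr1,
      ← ENNReal.rpow_mul, ← ENNReal.rpow_mul]
    have e1 : r * (q / r) = q := by field_simp
    have e2 : r / (r - 1) * (1 - q / r) = (r - q) / (r - 1) := by field_simp
    have e3 : w x = w x ^ (q / r) * w x ^ (1 - q / r) := by
      rw [← ENNReal.rpow_add _ _ (h x).1 (h x).2]; simp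
    rw [e1, e2]
    nth_rewrite 3 [e3]
    ring
  simp only [e] at H
  refine (ENNReal.rpow_le_rpow H (by positivity)).trans (le_of_eq ?_)
  rw [ENNReal.mul_rpow_of_nonneg _ _ (by positivity), ← ENNReal.rpow_mul, ← ENNReal.rpow_mul]
  congr 2
  · field_simp
  · field_simp

lemma stNorm_mono_weight {n : ℕ} (q : ℝ) (hq : 1 ≤ q) (v v' f : (Fin n → ℝ) → ℝ≥0∞) (A : ℝ≥0∞)
    (hv : Measurable v) (hf : Measurable f) (h : ∀ x, v' x ≤ A * v x) :
    stNorm q v' f ≤ A ^ (1 / q) * stNorm q v f := by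
  unfold stNorm
  rw [← ENNReal.mul_rpow_of_nonneg _ _ (by positivity), ← lintegral_const_mul _ (by fun_prop)]
  refine ENNReal.rpow_le_rpow (lintegral_mono fun x => ?_) (by positivity)
  calc f x ^ q * v' x ≤ f x ^ q * (A * v x) := by gcongr; exact h x
    _ = _ := by ring

lemma core {n : ℕ} (q r p : ℝ) (hq : 1 ≤ q) (hqr : q < r) (hp : 1 / p = 1 / q + 1 / r)
    (T : ((Fin n → ℝ) → ℝ≥0∞) → ((Fin n → ℝ) → ℝ≥0∞) → (Fin n → ℝ) → ℝ≥0∞)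
    (w₁ w₂ : (Fin n → ℝ) → ℝ≥0∞) (hw₁ : Measurable w₁) (hw₂ : Measurable w₂)
    (h₁ : ∀ x, w₁ x ≠ 0 ∧ w₁ x ≠ ⊤) (h₂ : ∀ x, w₂ x ≠ 0 ∧ w₂ x ≠ ⊤)
    (hA : apConst r w₁ ≠ ⊤)
    (φ : ℝ≥0∞ → ℝ≥0∞) (hφ : ∀ a, a ≠ ⊤ → φ a ≠ ⊤)
    (HT : ∀ v : (Fin n → ℝ) → ℝ≥0∞, Measurable v → apConst q v < ⊤ →
      ∀ f₁ f₂ : (Fin n → ℝ) → ℝ≥0∞, Measurable f₁ → Measurable f₂ →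
          wkNorm p (fun x => v x ^ (p / q) * w₂ x ^ (p / r)) (T f₁ f₂)
            ≤ φ (apConst q v) * (stNorm q v f₁ * stNorm r w₂ f₂)) :
    ∃ C : ℝ≥0∞, C ≠ ⊤ ∧
        ∀ f₁ f₂ : (Fin n → ℝ) → ℝ≥0∞, Measurable f₁ → Measurable f₂ →
          wkNorm (r / 2) (fun x => w₁ x ^ ((1:ℝ)/2) * w₂ x ^ ((1:ℝ)/2)) (T f₁ f₂)
            ≤ C * (stNorm r w₁ f₁ * stNorm r w₂ f₂) := by
  have hr : 0 < r := by linarith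
  have hrr : 1 < r := by linarith
  have hq0 : 0 < q := by linarith
  have hr1 : 0 < r - 1 := by linarith
  have hp0 : 0 < p := by
    have : 0 < 1 / p := by rw [hp]; positivity
    exact one_div_pos.1 this
  have hs0 : 0 < 1 / q - 1 / r := by
    rw [sub_pos]; exact one_div_lt_one_div_of_lt hq0 hqr
  obtain ⟨A, K, hA1, hK1, Hrdf⟩ := rdf r hrr w₁ hw₁ h₁ hA
  have hθ0 : 0 ≤ (q - 1) / (r - 1) := div_nonneg (by linarith) hr1.le
  have e1θ : 1 - (q - 1) / (r - 1) = (r - q) / (r - 1) := by field_simp; ring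
  have h1θ : 0 < (r - q) / (r - 1) := div_pos (by linarith) hr1
  set K' := apConst r w₁ ^ ((q - 1) / (r - 1)) * K ^ (1 - (q - 1) / (r - 1)) with hK'
  have hK'1 : K' ≠ ⊤ := by
    refine ENNReal.mul_ne_top (ENNReal.rpow_ne_top_of_nonneg hθ0 hA) (ENNReal.rpow_ne_top_of_nonneg ?_ hK1)
    rw [e1θ]; exact h1θ.le
  obtain ⟨Ψ, A', hΨ, hA', Htune⟩ := tune (n := n) q hq K' hK'1 φ hφ
  set s := 1 / q - 1 / r with hs
  refine ⟨Ψ * A' ^ (1 / q) * A ^ s, ?_, fun f₁ f₂ hf₁ hf₂ => ?_⟩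
  · exact ENNReal.mul_ne_top (ENNReal.mul_ne_top hΨ (ENNReal.rpow_ne_top_of_nonneg (by positivity) hA'))
      (ENNReal.rpow_ne_top_of_nonneg hs0.le hA1)
  set N₁ := stNorm r w₁ f₁
  set N₂ := stNorm r w₂ f₂
  set ω : (Fin n → ℝ) → ℝ≥0∞ := fun x => w₁ x ^ ((1:ℝ)/2) * w₂ x ^ ((1:ℝ)/2) with hω
  have mω : Measurable ω := by fun_prop
  have ωt : ∀ x, ω x ≠ ⊤ := fun x => ENNReal.mul_ne_top
    (ENNReal.rpow_ne_top_of_nonneg (by norm_num) (h₁ x).2)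
    (ENNReal.rpow_ne_top_of_nonneg (by norm_num) (h₂ x).2)
  unfold wkNorm
  refine iSup_le fun y => ?_
  rcases eq_or_ne y 0 with rfl | y0
  · rw [zero_mul]; exact bot_le
  rcases eq_or_ne y ⊤ with rfl | yt
  · have : {x | (⊤:ℝ≥0∞) < T f₁ f₂ x} = ∅ := by ext x; simp
    rw [this, wMeas, setLIntegral_empty, ENNReal.zero_rpow_of_pos (by positivity), mul_zero]
    exact bot_le
  set E := {x | y < T f₁ f₂ x} with hE
  set E' := toMeasurable volume E with hE'
  have mE' : MeasurableSet E' := measurableSet_toMeasurable _ _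
  have hEE : ∀ g : (Fin n → ℝ) → ℝ≥0∞, wMeas g E = ∫⁻ x in E', g x := by
    intro g
    rw [wMeas, hE', Measure.restrict_toMeasurable_of_sFinite]
  -- main estimate on subsets of finite measure
  have main : ∀ F, MeasurableSet F → F ⊆ E' → ∫⁻ x in F, ω x ≠ 0 → ∫⁻ x in F, ω x ≠ ⊤ →
      y * (∫⁻ x in F, ω x) ^ (2 / r) ≤ Ψ * A' ^ (1 / q) * A ^ s * (N₁ * N₂) := by
    intro F mF hF I0 I1
    set I := ∫⁻ x in F, ω x with hI
    set u : (Fin n → ℝ) → ℝ≥0∞ := F.indicator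
      (fun x => w₁ x ^ (-((r - 1) / (2 * r))) * w₂ x ^ ((r - 1) / (2 * r))) with hu
    have mu : Measurable u := Measurable.indicator (by fun_prop) mF
    obtain ⟨R, mR, huR, hRA, hRK⟩ := Hrdf u mu
    have h_integ : ∫⁻ x, u x ^ (r / (r - 1)) * w₁ x = I := by
      rw [hI, ← lintegral_indicator mF]
      refine lintegral_congr fun x => ?_
      by_cases hx : x ∈ F
      · rw [hu, indicator_of_mem hx, indicator_of_mem hx, hω]
        simp only
        rw [ENNReal.mul_rpow_of_nonneg _ _ (by positivity), ← ENNReal.rpow_mul, ← ENNReal.rpow_mul]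
        have e1 : -((r - 1) / (2 * r)) * (r / (r - 1)) = -(1/2) := by field_simp
        have e2 : (r - 1) / (2 * r) * (r / (r - 1)) = 1/2 := by field_simp
        rw [e1, e2, mul_right_comm]
        nth_rewrite 2 [← ENNReal.rpow_one (w₁ x)]
        rw [← ENNReal.rpow_add _ _ (h₁ x).1 (h₁ x).2]
        norm_num
      · rw [hu, indicator_of_notMem hx, indicator_of_notMem hx, ENNReal.zero_rpow_of_pos (by positivity),
          zero_mul]
    rw [h_integ] at hRA
    set U : (Fin n → ℝ) → ℝ≥0∞ := fun y => R y * w₁ y with hU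
    have mU : Measurable U := mR.mul hw₁
    have hap := ap_interp q r hq hqr w₁ U hw₁ mU h₁ K hK1 hRK
    set v : (Fin n → ℝ) → ℝ≥0∞ := fun x => w₁ x * R x ^ ((r - q) / (r - 1)) with hv
    have mv : Measurable v := by fun_prop
    have hveq : (fun x => w₁ x ^ ((q - 1) / (r - 1)) * U x ^ (1 - (q - 1) / (r - 1))) = v := by
      funext x
      simp only [hU, hv]
      rw [ENNReal.mul_rpow_of_nonneg _ _ (by rw [e1θ]; exact h1θ.le), mul_left_comm,
        ← ENNReal.rpow_add _ _ (h₁ x).1 (h₁ x).2, e1θ]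
      have : (q - 1) / (r - 1) + (r - q) / (r - 1) = 1 := by field_simp; ring
      rw [this, ENNReal.rpow_one, mul_comm]
    rw [hveq] at hap
    have hRpos : ∀ x, R x ≠ 0 := by
      intro x hx
      have h3 := hRK x
      rw [hx, zero_mul, mul_zero, nonpos_iff_eq_zero] at h3
      have h4 := maxOp_eq_zero _ x h3
      rw [lintegral_eq_zero_iff mU] at h4
      apply I0
      rw [← nonpos_iff_eq_zero, ← h_integ]
      calc ∫⁻ x, u x ^ (r / (r - 1)) * w₁ x ≤ ∫⁻ x, R x ^ (r / (r - 1)) * w₁ x := by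
            refine lintegral_mono fun x => mul_le_mul_left (ENNReal.rpow_le_rpow (huR x) (by positivity)) _
        _ = ∫⁻ x : (Fin n → ℝ), 0 := by
            refine lintegral_congr_ae ?_
            filter_upwards [h4] with x hx
            have : R x = 0 := by
              rcases mul_eq_zero.1 hx with h | h
              · exact h
              · exact absurd h (h₁ x).1
            rw [this, ENNReal.zero_rpow_of_pos (by positivity), zero_mul]
        _ ≤ 0 := by simp
    have hRfin : ∀ᵐ x, R x ≠ ⊤ := by
      have h3 : ∫⁻ x, R x ^ (r / (r - 1)) * w₁ x ≠ ⊤ := ne_top_of_le_ne_top (ENNReal.mul_ne_top hA1 I1) hRA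
      filter_upwards [ae_lt_top (by fun_prop) h3] with x hx hx'
      rw [hx', ENNReal.top_rpow_of_pos (by positivity), ENNReal.top_mul (h₁ x).1] at hx
      exact lt_irrefl _ hx
    have hv0 : ∀ᵐ x, v x ≠ 0 ∧ v x ≠ ⊤ := by
      filter_upwards [hRfin] with x hx
      exact ⟨mul_ne_zero (h₁ x).1 (by simp [ENNReal.rpow_eq_zero_iff, hx, hRpos x]),
        ENNReal.mul_ne_top (h₁ x).2 (ENNReal.rpow_ne_top_of_nonneg h1θ.le hx)⟩
    obtain ⟨v', mv', hvv', hv'v, hapv', hφv'⟩ := Htune v mv hv0 hap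
    have HT' := HT v' mv' hapv' f₁ f₂ hf₁ hf₂
    have L : y * I ^ (1 / p) ≤ φ (apConst q v') * (stNorm q v' f₁ * N₂) := by
      refine le_trans ?_ (le_trans (le_iSup (fun y : ℝ≥0∞ => y *
        (wMeas (fun x => v' x ^ (p / q) * w₂ x ^ (p / r)) {x | y < T f₁ f₂ x}) ^ (1 / p)) y) HT')
      refine mul_le_mul_right (ENNReal.rpow_le_rpow ?_ (by positivity)) _
      rw [← hE, hEE]
      refine le_trans (setLIntegral_mono' mF fun x hx => ?_) (lintegral_mono_set hF)
      have hux := huR x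
      rw [hu, indicator_of_mem hx] at hux
      exact weight_lower q r p hq hqr hp _ _ (R x) _ (h₁ x).1 (h₁ x).2 (h₂ x).1 (h₂ x).2 hux (hvv' x)
    have B : stNorm q v' f₁ ≤ A' ^ (1 / q) * (N₁ * (A * I) ^ s) := by
      refine (stNorm_mono_weight q hq v v' f₁ A' mv hf₁ hv'v).trans (mul_le_mul_right ?_ _)
      refine (holder_weight q r hq hqr w₁ R f₁ hw₁ mR hf₁ h₁).trans (mul_le_mul_right ?_ _)
      exact ENNReal.rpow_le_rpow hRA hs0.le
    have IS0 : I ^ s ≠ 0 := by simp [ENNReal.rpow_eq_zero_iff, I0, I1]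
    have IS1 : I ^ s ≠ ⊤ := ENNReal.rpow_ne_top_of_nonneg hs0.le I1
    rw [← ENNReal.mul_le_mul_iff_left IS0 IS1, mul_assoc, ← ENNReal.rpow_add _ _ I0 I1]
    have ex : 2 / r + s = 1 / p := by rw [hp, hs]; ring
    rw [ex]
    calc _ ≤ _ := L
      _ ≤ Ψ * (A' ^ (1 / q) * (N₁ * (A * I) ^ s) * N₂) :=
          mul_le_mul' hφv' (mul_le_mul_left B _)
      _ = _ := by
          rw [ENNReal.mul_rpow_of_nonneg _ _ hs0.le]; ring
  -- exhaust
  rw [hEE]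
  set B := Ψ * A' ^ (1 / q) * A ^ s * (N₁ * N₂)
  have e2r : 1 / (r / 2) = (r / 2)⁻¹ := one_div _
  have e2r' : 2 / r = (r / 2)⁻¹ := by rw [inv_div]
  have hr2 : 0 < r / 2 := by positivity
  rw [e2r, mul_comm, ← ENNReal.le_div_iff_mul_le (Or.inl y0) (Or.inl yt), ENNReal.rpow_inv_le_iff hr2]
  rw [← withDensity_apply _ mE']
  have : SigmaFinite ((volume : Measure (Fin n → ℝ)).withDensity ω) :=
    SigmaFinite.withDensity_of_ne_top (ae_of_all _ ωt)
  refine le_of_forall_lt fun c hc => ?_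
  obtain ⟨F, mF, hF, hcF, hFt⟩ := Measure.exists_subset_measure_lt_top mE' hc
  rw [withDensity_apply _ mF] at hcF hFt
  have := main F mF hF (ne_bot_of_gt hcF) hFt.ne
  rw [e2r', mul_comm, ← ENNReal.le_div_iff_mul_le (Or.inl y0) (Or.inl yt), ENNReal.rpow_inv_le_iff hr2] at this
  exact hcF.trans_le this

lemma exists_ball_pos {n : ℕ} (A : Set (Fin n → ℝ)) (hA : volume A ≠ 0) :
    ∃ k : ℕ, volume (A ∩ Metric.closedBall 0 k) ≠ 0 := by
  by_contra! h
  apply hA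
  have := measure_iUnion_null h
  rwa [← inter_iUnion, Metric.iUnion_closedBall_nat, inter_univ] at this

lemma dichot {n : ℕ} (f g : (Fin n → ℝ) → ℝ≥0∞) (hf : Measurable f) (hg : Measurable g)
    (H : ∀ Q : Set (Fin n → ℝ), IsCube Q → ¬ ((∫⁻ x in Q, f x) = ⊤ ∧ (∫⁻ x in Q, g x) ≠ 0)) :
    (∀ᵐ x, f x ≠ ⊤) ∨ (∀ᵐ x, g x = 0) := by
  by_contra! h
  obtain ⟨h1, h2⟩ := h
  have h1' : volume {x | f x = ⊤} ≠ 0 := by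
    intro h; apply h1; rw [ae_iff]; simpa using h
  have h2' : volume {x | g x ≠ 0} ≠ 0 := by
    intro h; apply h2; rw [ae_iff]; simpa using h
  obtain ⟨k, hk⟩ := exists_ball_pos _ h1'
  obtain ⟨l, hl⟩ := exists_ball_pos _ h2'
  set Q : Set (Fin n → ℝ) := Metric.closedBall 0 ((k:ℝ) + l + 1) with hQ
  have cQ : IsCube Q := isCube_iff.2 ⟨_, _, by positivity, rfl⟩
  obtain ⟨v0, v1, mQ⟩ := cube_vol cQ
  have kQ : Metric.closedBall (0 : Fin n → ℝ) k ⊆ Q :=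
    Metric.closedBall_subset_closedBall (by have : (0:ℝ) ≤ l := by positivity
                                            linarith)
  have lQ : Metric.closedBall (0 : Fin n → ℝ) l ⊆ Q :=
    Metric.closedBall_subset_closedBall (by have : (0:ℝ) ≤ k := by positivity
                                            linarith)
  refine H Q cQ ⟨?_, ?_⟩
  · by_contra h
    have h3 := ae_lt_top hf h
    rw [ae_restrict_iff' mQ] at h3
    apply hk
    rw [measure_eq_zero_iff_ae_notMem]
    filter_upwards [h3] with x hx hx'
    exact (hx (kQ hx'.2)).ne hx'.1
  · intro h
    rw [setLIntegral_eq_zero_iff mQ hg] at h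
    apply hl
    rw [measure_eq_zero_iff_ae_notMem]
    filter_upwards [h] with x hx hx'
    exact hx'.1 (hx (lQ hx'.2))

lemma trichot {n : ℕ} (r : ℝ) (hr : 1 < r) (w : (Fin n → ℝ) → ℝ≥0∞) (hw : Measurable w)
    (hA : apConst r w < ⊤) :
    (∀ᵐ x, w x = 0) ∨ (∀ᵐ x, w x = ⊤) ∨ (∀ᵐ x, w x ≠ 0 ∧ w x ≠ ⊤) := by
  have hr1 : 0 < r - 1 := by linarith
  have hs : -1 / (r - 1) < 0 := div_neg_of_neg_of_pos (by norm_num) hr1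
  have fin : ∀ Q : Set (Fin n → ℝ), IsCube Q →
      (∫⁻ x in Q, w x) * (∫⁻ x in Q, w x ^ (-1 / (r - 1))) ^ (r - 1) ≠ ⊤ := by
    intro Q hQ
    refine ne_top_of_le_ne_top (ENNReal.mul_ne_top hA.ne ?_) (cube_prod_le r hr w hQ)
    exact ENNReal.rpow_ne_top_of_nonneg (by linarith) (cube_vol hQ).2.1
  have D1 := dichot w (fun x => w x ^ (-1 / (r - 1))) hw (by fun_prop) (by
    rintro Q hQ ⟨h1, h2⟩
    apply fin Q hQ
    rw [h1, ENNReal.top_mul]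
    simp only [ne_eq, ENNReal.rpow_eq_zero_iff, h2, false_and, false_or, not_and]
    intro _; linarith)
  have D2 := dichot (fun x => w x ^ (-1 / (r - 1))) w (by fun_prop) hw (by
    rintro Q hQ ⟨h1, h2⟩
    apply fin Q hQ
    rw [h1, ENNReal.top_rpow_of_pos hr1, ENNReal.mul_top h2])
  rcases D2 with D2 | D2
  · rcases D1 with D1 | D1
    · right; right
      filter_upwards [D1, D2] with x h1 h2
      refine ⟨fun h => h2 ?_, h1⟩
      rw [h, ENNReal.zero_rpow_of_neg hs]
    · right; left
      filter_upwards [D1] with x h1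
      rw [ENNReal.rpow_eq_zero_iff] at h1
      rcases h1 with h1 | h1
      · linarith [h1.2]
      · exact h1.1
  · exact Or.inl D2

lemma cubeAvg_congr {n : ℕ} {w w' : (Fin n → ℝ) → ℝ≥0∞} (h : w =ᵐ[volume] w') (Q) :
    cubeAvg w Q = cubeAvg w' Q := by
  unfold cubeAvg
  rw [lintegral_congr_ae (ae_restrict_of_ae h)]

lemma apConst_congr {n : ℕ} (q : ℝ) {w w' : (Fin n → ℝ) → ℝ≥0∞} (hq : 1 < q) (h : w =ᵐ[volume] w') :
    apConst q w = apConst q w' := by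
  have h2 : (fun x => w x ^ (-1 / (q - 1))) =ᵐ[volume] fun x => w' x ^ (-1 / (q - 1)) := by
    filter_upwards [h] with x hx
    rw [hx]
  simp only [apConst, if_neg hq.ne', cubeAvg_congr h, cubeAvg_congr h2]

lemma stNorm_congr {n : ℕ} (q : ℝ) {w w' : (Fin n → ℝ) → ℝ≥0∞} (f) (h : w =ᵐ[volume] w') :
    stNorm q w f = stNorm q w' f := by
  unfold stNorm
  congr 1
  refine lintegral_congr_ae ?_
  filter_upwards [h] with x hx
  rw [hx]

lemma wkNorm_congr {n : ℕ} (q : ℝ) {w w' : (Fin n → ℝ) → ℝ≥0∞} (f) (h : w =ᵐ[volume] w') :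
    wkNorm q w f = wkNorm q w' f := by
  unfold wkNorm wMeas
  simp_rw [lintegral_congr_ae (ae_restrict_of_ae h)]

lemma wkNorm_zero {n : ℕ} (q : ℝ) (hq : 0 < q) (w g : (Fin n → ℝ) → ℝ≥0∞)
    (h : ∀ y : ℝ≥0∞, y ≠ 0 → wMeas w {x | y < g x} = 0) : wkNorm q w g = 0 := by
  unfold wkNorm
  rw [← nonpos_iff_eq_zero]
  refine iSup_le fun y => ?_
  rcases eq_or_ne y 0 with rfl | y0
  · simp
  · rw [h y y0, ENNReal.zero_rpow_of_pos (by positivity), mul_zero]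

/-- If the `v`-weak norm vanishes for an a.e. positive `v`, all weak norms vanish. -/
lemma wkNorm_zero_of {n : ℕ} (p q : ℝ) (hp : 0 < p) (hq : 0 < q) (v w g : (Fin n → ℝ) → ℝ≥0∞)
    (hv : Measurable v) (v0 : ∀ᵐ x, v x ≠ 0) (h : wkNorm p v g = 0) : wkNorm q w g = 0 := by
  refine wkNorm_zero q hq w g fun y y0 => ?_
  have h1 : y * (wMeas v {x | y < g x}) ^ (1 / p) ≤ 0 := by
    rw [← h]
    exact le_iSup (fun y : ℝ≥0∞ => y * (wMeas v {x | y < g x}) ^ (1 / p)) y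
  rw [nonpos_iff_eq_zero, mul_eq_zero, or_iff_right y0, ENNReal.rpow_eq_zero_iff] at h1
  have hp' : 0 < 1 / p := by positivity
  have h2 : wMeas v {x | y < g x} = 0 := by
    rcases h1 with h1 | h1
    · exact h1.1
    · linarith [h1.2]
  unfold wMeas at h2 ⊢
  rw [lintegral_eq_zero_iff hv] at h2
  rw [lintegral_congr_ae (g := fun _ => 0)]
  · simp
  · filter_upwards [h2, ae_restrict_of_ae v0] with x hx hx'
    exact absurd hx hx'

lemma stNorm_eq_zero {n : ℕ} (q : ℝ) (hq : 0 < q) (w f : (Fin n → ℝ) → ℝ≥0∞) (hw : Measurable w)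
    (hf : Measurable f) (w0 : ∀ᵐ x, w x ≠ 0) (h : stNorm q w f = 0) : ∀ᵐ x, f x = 0 := by
  unfold stNorm at h
  have hq' : 0 < 1 / q := by positivity
  rw [ENNReal.rpow_eq_zero_iff] at h
  have h2 : ∫⁻ x, f x ^ q * w x = 0 := by
    rcases h with h | h
    · exact h.1
    · linarith [h.2]
  rw [lintegral_eq_zero_iff (by fun_prop)] at h2
  filter_upwards [h2, w0] with x hx hx'
  rcases mul_eq_zero.1 hx with h3 | h3
  · rw [ENNReal.rpow_eq_zero_iff] at h3
    rcases h3 with h3 | h3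
    · exact h3.1
    · linarith [h3.2]
  · exact absurd h3 hx'

lemma stNorm_top {n : ℕ} (q : ℝ) (hq : 0 < q) (w f : (Fin n → ℝ) → ℝ≥0∞)
    (hf : Measurable f) (w0 : ∀ᵐ x, w x = ⊤) (h : stNorm q w f ≠ 0) : stNorm q w f = ⊤ := by
  unfold stNorm at h ⊢
  have hq' : 0 < 1 / q := by positivity
  have e : ∫⁻ x, f x ^ q * w x = (∫⁻ x, f x ^ q) * ⊤ := by
    rw [← lintegral_mul_const _ (by fun_prop)]
    refine lintegral_congr_ae ?_
    filter_upwards [w0] with x hx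
    rw [hx]
  rw [e] at h ⊢
  have : ∫⁻ x, f x ^ q ≠ 0 := by
    intro h2
    rw [h2, zero_mul, ENNReal.zero_rpow_of_pos hq'] at h
    exact h rfl
  rw [ENNReal.mul_top this, ENNReal.top_rpow_of_pos hq']

theorem stmt19 {n : ℕ} (p₁ p₂ p : ℝ) (h1 : 1 ≤ p₁) (h12 : p₁ ≤ p₂)
    (hp : 1 / p = 1 / p₁ + 1 / p₂)
    (T : ((Fin n → ℝ) → ℝ≥0∞) → ((Fin n → ℝ) → ℝ≥0∞) → (Fin n → ℝ) → ℝ≥0∞)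
    -- T : L^{p₁}(w₁) × L^{p₂}(w₂) → L^{p,∞}(w₁^{p/p₁} w₂^{p/p₂}) uniformly for
    -- all w₁ ∈ A_{p₁}, w₂ ∈ A_{p₂}
    (HT : ∃ ψ : ℝ≥0∞ → ℝ≥0∞ → ℝ≥0∞, (∀ a b, a ≠ ⊤ → b ≠ ⊤ → ψ a b ≠ ⊤) ∧
      ∀ w₁ w₂ : (Fin n → ℝ) → ℝ≥0∞, Measurable w₁ → Measurable w₂ →
        apConst p₁ w₁ < ⊤ → apConst p₂ w₂ < ⊤ →
        ∀ f₁ f₂ : (Fin n → ℝ) → ℝ≥0∞, Measurable f₁ → Measurable f₂ →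
          wkNorm p (fun x => w₁ x ^ (p / p₁) * w₂ x ^ (p / p₂)) (T f₁ f₂)
            ≤ ψ (apConst p₁ w₁) (apConst p₂ w₂) * (stNorm p₁ w₁ f₁ * stNorm p₂ w₂ f₂)) :
    ∀ w₁ w₂ : (Fin n → ℝ) → ℝ≥0∞, Measurable w₁ → Measurable w₂ →
      apConst p₂ w₁ < ⊤ → apConst p₂ w₂ < ⊤ →
      ∃ C : ℝ≥0∞, C < ⊤ ∧
        ∀ f₁ f₂ : (Fin n → ℝ) → ℝ≥0∞, Measurable f₁ → Measurable f₂ →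
          wkNorm (p₂ / 2) (fun x => w₁ x ^ ((1:ℝ)/2) * w₂ x ^ ((1:ℝ)/2)) (T f₁ f₂)
            ≤ C * (stNorm p₂ w₁ f₁ * stNorm p₂ w₂ f₂) := by
  obtain ⟨ψ, hψ, HT⟩ := HT
  intro w₁ w₂ m₁ m₂ A₁ A₂
  have hp1 : 0 < p₁ := by linarith
  have hp2 : 0 < p₂ := by linarith
  have hp0 : 0 < p := by
    have : 0 < 1 / p := by rw [hp]; positivity
    exact one_div_pos.1 this
  rcases h12.eq_or_lt with rfl | h12'
  · have hpe : p = p₁ / 2 := by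
      have : p = 1 / (1 / p) := by simp
      rw [this, hp]; field_simp; norm_num
    have e : p₁ / 2 / p₁ = 1 / 2 := by field_simp
    refine ⟨ψ (apConst p₁ w₁) (apConst p₁ w₂), (hψ _ _ A₁.ne A₂.ne).lt_top, fun f₁ f₂ hf₁ hf₂ => ?_⟩
    have := HT w₁ w₂ m₁ m₂ A₁ A₂ f₁ f₂ hf₁ hf₂
    rwa [hpe, e] at this
  have hr : 1 < p₂ := by linarith
  have hr2 : 0 < p₂ / 2 := by positivity
  -- a zero weight
  have Zw : (∀ᵐ x, w₁ x ^ ((1:ℝ)/2) * w₂ x ^ ((1:ℝ)/2) = 0) → ∃ C : ℝ≥0∞, C < ⊤ ∧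
        ∀ f₁ f₂ : (Fin n → ℝ) → ℝ≥0∞, Measurable f₁ → Measurable f₂ →
          wkNorm (p₂ / 2) (fun x => w₁ x ^ ((1:ℝ)/2) * w₂ x ^ ((1:ℝ)/2)) (T f₁ f₂)
            ≤ C * (stNorm p₂ w₁ f₁ * stNorm p₂ w₂ f₂) := by
    intro h
    refine ⟨0, by simp, fun f₁ f₂ _ _ => ?_⟩
    rw [wkNorm_zero _ hr2]
    · exact bot_le
    · intro y _
      rw [wMeas, lintegral_congr_ae (g := fun _ => 0) (ae_restrict_of_ae h)]
      simp
  -- vanishing norms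
  have Zn : (∀ᵐ x, w₁ x ≠ 0) → (∀ᵐ x, w₂ x ≠ 0) → ∀ f₁ f₂ : (Fin n → ℝ) → ℝ≥0∞,
      Measurable f₁ → Measurable f₂ → stNorm p₂ w₁ f₁ = 0 ∨ stNorm p₂ w₂ f₂ = 0 →
      wkNorm (p₂ / 2) (fun x => w₁ x ^ ((1:ℝ)/2) * w₂ x ^ ((1:ℝ)/2)) (T f₁ f₂) = 0 := by
    intro h₁ h₂ f₁ f₂ hf₁ hf₂ hz
    have hc := apConst_const (n := n) p₁ h1 1 one_ne_zero one_ne_top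
    have H := HT (fun _ => 1) w₂ measurable_const m₂ (by rw [hc]; simp) A₂ f₁ f₂ hf₁ hf₂
    have hz2 : stNorm p₁ (fun _ => 1) f₁ * stNorm p₂ w₂ f₂ = 0 := by
      rcases hz with hz | hz
      · have h3 := stNorm_eq_zero p₂ hp2 w₁ f₁ m₁ hf₁ h₁ hz
        have : stNorm p₁ (fun _ => 1) f₁ = 0 := by
          unfold stNorm
          rw [lintegral_congr_ae (g := fun _ => 0)]
          · simp [hp1]
          · filter_upwards [h3] with x hx
            rw [hx, ENNReal.zero_rpow_of_pos hp1, zero_mul]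
        rw [this, zero_mul]
      · rw [hz, mul_zero]
    rw [hz2, mul_zero, nonpos_iff_eq_zero] at H
    refine wkNorm_zero_of p _ hp0 hr2 _ _ _ (by fun_prop) ?_ H
    filter_upwards [h₂] with x hx
    rw [ENNReal.one_rpow, one_mul, ne_eq, ENNReal.rpow_eq_zero_iff]
    have : 0 < p / p₂ := by positivity
    rintro (h | h)
    · exact hx h.1
    · linarith [h.2]
  -- an infinite weight
  have Tw : (∀ᵐ x, w₁ x ≠ 0) → (∀ᵐ x, w₂ x ≠ 0) → ((∀ᵐ x, w₁ x = ⊤) ∨ (∀ᵐ x, w₂ x = ⊤)) →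
      ∃ C : ℝ≥0∞, C < ⊤ ∧
        ∀ f₁ f₂ : (Fin n → ℝ) → ℝ≥0∞, Measurable f₁ → Measurable f₂ →
          wkNorm (p₂ / 2) (fun x => w₁ x ^ ((1:ℝ)/2) * w₂ x ^ ((1:ℝ)/2)) (T f₁ f₂)
            ≤ C * (stNorm p₂ w₁ f₁ * stNorm p₂ w₂ f₂) := by
    intro h₁ h₂ ht
    refine ⟨1, by simp, fun f₁ f₂ hf₁ hf₂ => ?_⟩
    by_cases hz : stNorm p₂ w₁ f₁ = 0 ∨ stNorm p₂ w₂ f₂ = 0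
    · rw [Zn h₁ h₂ f₁ f₂ hf₁ hf₂ hz]; exact bot_le
    · push Not at hz
      have : stNorm p₂ w₁ f₁ * stNorm p₂ w₂ f₂ = ⊤ := by
        rcases ht with ht | ht
        · rw [stNorm_top p₂ hp2 w₁ f₁ hf₁ ht hz.1, ENNReal.top_mul hz.2]
        · rw [stNorm_top p₂ hp2 w₂ f₂ hf₂ ht hz.2, ENNReal.mul_top hz.1]
      rw [this, one_mul]; exact le_top
  rcases trichot p₂ hr w₁ m₁ A₁ with z₁ | t₁
  · apply Zw
    filter_upwards [z₁] with x hx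
    rw [hx, ENNReal.zero_rpow_of_pos (by norm_num), zero_mul]
  rcases trichot p₂ hr w₂ m₂ A₂ with z₂ | t₂
  · apply Zw
    filter_upwards [z₂] with x hx
    rw [hx, ENNReal.zero_rpow_of_pos (by norm_num), mul_zero]
  have n₁ : ∀ᵐ x, w₁ x ≠ 0 := by
    rcases t₁ with t | t
    · filter_upwards [t] with x hx; rw [hx]; simp
    · filter_upwards [t] with x hx; exact hx.1
  have n₂ : ∀ᵐ x, w₂ x ≠ 0 := by
    rcases t₂ with t | t
    · filter_upwards [t] with x hx; rw [hx]; simp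
    · filter_upwards [t] with x hx; exact hx.1
  rcases t₁ with t₁ | g₁
  · exact Tw n₁ n₂ (Or.inl t₁)
  rcases t₂ with t₂ | g₂
  · exact Tw n₁ n₂ (Or.inr t₂)
  have rep : ∀ w : (Fin n → ℝ) → ℝ≥0∞, Measurable w → (∀ᵐ x, w x ≠ 0 ∧ w x ≠ ⊤) →
      ∃ w' : (Fin n → ℝ) → ℝ≥0∞, Measurable w' ∧ (∀ x, w' x ≠ 0 ∧ w' x ≠ ⊤) ∧ w =ᵐ[volume] w' := by
    intro w hw h
    classical
    refine ⟨fun x => if w x ≠ 0 ∧ w x ≠ ⊤ then w x else 1, ?_, fun x => ?_, ?_⟩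
    · refine Measurable.ite ?_ hw measurable_const
      exact hw (MeasurableSet.inter (measurableSet_singleton 0).compl (measurableSet_singleton ⊤).compl)
    · dsimp only
      split_ifs with hx
      · exact hx
      · simp
    · filter_upwards [h] with x hx
      rw [if_pos hx]
  obtain ⟨w₁', m₁', p₁', e₁⟩ := rep w₁ m₁ g₁
  obtain ⟨w₂', m₂', p₂', e₂⟩ := rep w₂ m₂ g₂
  have A₁' : apConst p₂ w₁' ≠ ⊤ := by rw [← apConst_congr p₂ hr e₁]; exact A₁.ne
  have A₂' : apConst p₂ w₂' < ⊤ := by rw [← apConst_congr p₂ hr e₂]; exact A₂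
  obtain ⟨C, hC, HC⟩ := core p₁ p₂ p h1 h12' hp T w₁' w₂' m₁' m₂' p₁' p₂' A₁'
    (fun a => ψ a (apConst p₂ w₂')) (fun a ha => hψ _ _ ha A₂'.ne)
    (fun v hv hav f₁ f₂ hf₁ hf₂ => HT v w₂' hv m₂' hav A₂' f₁ f₂ hf₁ hf₂)
  refine ⟨C, hC.lt_top, fun f₁ f₂ hf₁ hf₂ => ?_⟩
  rw [stNorm_congr p₂ f₁ e₁, stNorm_congr p₂ f₂ e₂, wkNorm_congr (w' := fun x => w₁' x ^ ((1:ℝ)/2) * w₂' x ^ ((1:ℝ)/2))]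
  · exact HC f₁ f₂ hf₁ hf₂
  · filter_upwards [e₁, e₂] with x hx hx'
    rw [hx, hx']

end
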